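/- arXiv:2110.15406 — 3 statements merged into one kernel-verified Lean document; each statement's English description precedes it below -/
import Mathlib

section
/- Fix n ≥ 1, d ≥ 1, a covariate matrix X ∈ ℝ^{n×d} with rows X_1,…,X_n, and group labels Z ∈ {1,…,H}ⁿ, and suppose Y = f₀(X) + ε, where f₀(x) = β₀ + Σ_{k=1}^d β_k x_k is an affine function with coefficients (β₀,β₁,…,β_d) ∈ ℝ^{d+1}, f₀(X) = (f₀(X_1),…,f₀(X_n))ᵀ, and ε ~ N(0, σ₀² I_n) with σ₀ > 0. Then for the linear kernel K_Linear(x,x') = 1 + xᵀx', any permutation size b with 1 ≤ b ≤ n − (d+1), and any test statistic T, both the discrete and the continuous partial permutation p-values are valid: Pr(p(X,Y,Z) ≤ α) ≤ α for every α ∈ (0,1). -/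
open MeasureTheory ProbabilityTheory Filter

noncomputable section

namespace PPT

/-- The law of `k` i.i.d. standard Gaussian random variables. -/
def stdGaussianPi (k : ℕ) : Measure (Fin k → ℝ) :=
  Measure.pi fun _ => gaussianReal 0 1

/-- The law of `n` i.i.d. centered Gaussian noises with standard deviation `σ`. -/
def noiseLaw (n : ℕ) (σ : ℝ) : Measure (Fin n → ℝ) :=
  Measure.pi fun _ => gaussianReal 0 ((σ ^ 2).toNNReal)

/-- Matrix (given as a function) times vector. -/
def mulVecF {n m : ℕ} (A : Fin n → Fin m → ℝ) (v : Fin m → ℝ) : Fin n → ℝ :=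
  fun i => ∑ j, A i j * v j

/-- Transposed matrix times vector, `Aᵀ v`. -/
def tmulVecF {n : ℕ} (A : Fin n → Fin n → ℝ) (v : Fin n → ℝ) : Fin n → ℝ :=
  fun i => ∑ j, A j i * v j

/-- Matrix product of matrices given as functions. -/
def mulF {n : ℕ} (A B : Fin n → Fin n → ℝ) : Fin n → Fin n → ℝ :=
  fun i j => ∑ k, A i k * B k j

/-- The identity matrix as a function. -/
def idF (n : ℕ) : Fin n → Fin n → ℝ :=
  fun i j => if i = j then 1 else 0

/-- Quadratic form `vᵀ A v`. -/
def quadForm {n : ℕ} (A : Fin n → Fin n → ℝ) (v : Fin n → ℝ) : ℝ :=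
  ∑ i, ∑ j, v i * A i j * v j

/-- `A` is an orthogonal matrix: `A Aᵀ = I`. -/
def IsOrthogonalF {n : ℕ} (A : Fin n → Fin n → ℝ) : Prop :=
  ∀ i j, (∑ k, A i k * A j k) = if i = j then (1 : ℝ) else 0

/-- `(Γ, c)` is an eigendecomposition `Kmat = Γ diag(c) Γᵀ` of `Kmat`, with `Γ` orthogonal and
the eigenvalues `c` nonnegative and in nonincreasing order. -/
def IsEigenDecomp {n : ℕ} (Kmat Γ : Fin n → Fin n → ℝ) (c : Fin n → ℝ) : Prop :=
  IsOrthogonalF Γ ∧ (∀ i j, Kmat i j = ∑ k, Γ i k * c k * Γ j k) ∧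
    (∀ i j : Fin n, i ≤ j → c j ≤ c i) ∧ (∀ i, 0 ≤ c i)

/-- A symmetric positive semidefinite kernel on `ℝᵈ`. -/
def IsPSDKernel {d : ℕ} (K : (Fin d → ℝ) → (Fin d → ℝ) → ℝ) : Prop :=
  (∀ x y, K x y = K y x) ∧
    ∀ (m : ℕ) (v : Fin m → (Fin d → ℝ)) (a : Fin m → ℝ),
      0 ≤ ∑ i, ∑ j, a i * a j * K (v i) (v j)

/-- The set `M(n,b)` of permutations of `{0, …, n-1}` keeping the first `n - b` elements fixed. -/
def permSet (n b : ℕ) : Finset (Equiv.Perm (Fin n)) :=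
  Finset.univ.filter fun ψ => ∀ i : Fin n, (i : ℕ) < n - b → ψ i = i

/-- The discrete partial permutation p-value, with covariates `X`, group labels `Z`,
test statistic `T`, eigenvector matrix `Γ`, permutation size `b` and responses `Y`. -/
def pDisc {n d H : ℕ} (X : Fin n → Fin d → ℝ) (Z : Fin n → Fin H)
    (T : (Fin n → Fin d → ℝ) → (Fin n → ℝ) → (Fin n → Fin H) → ℝ)
    (Γ : Fin n → Fin n → ℝ) (b : ℕ) (Y : Fin n → ℝ) : ℝ :=
  ((permSet n b).card : ℝ)⁻¹ *
    ∑ ψ ∈ permSet n b,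
      if T X Y Z ≤ T X (mulVecF Γ ((tmulVecF Γ Y) ∘ ψ)) Z then 1 else 0

/-- Squared norm of the last `b` coordinates of a vector in `ℝⁿ`. -/
def tailNormSq {n : ℕ} (b : ℕ) (w : Fin n → ℝ) : ℝ :=
  ∑ i ∈ Finset.univ.filter (fun i : Fin n => n - b ≤ (i : ℕ)), w i ^ 2

/-- The continuous partial permutation of `w` driven by `g`: it agrees with `w` on the first
`n - b` coordinates, and its last `b` coordinates are those of `g` rescaled to lie on the sphere
of radius `(Σ_{i ≥ n-b} w i ^ 2)^{1/2}`.  When `g` is standard Gaussian, the last `b` coordinates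
are uniformly distributed on that sphere. -/
def wStar {n : ℕ} (b : ℕ) (w g : Fin n → ℝ) : Fin n → ℝ := fun i =>
  if (i : ℕ) < n - b then w i
  else Real.sqrt (tailNormSq b w) * g i / Real.sqrt (tailNormSq b g)

/-- The continuous partial permutation p-value. -/
def pCont {n d H : ℕ} (X : Fin n → Fin d → ℝ) (Z : Fin n → Fin H)
    (T : (Fin n → Fin d → ℝ) → (Fin n → ℝ) → (Fin n → Fin H) → ℝ)
    (Γ : Fin n → Fin n → ℝ) (b : ℕ) (Y : Fin n → ℝ) : ℝ :=
  (stdGaussianPi n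
    {g | T X Y Z ≤ T X (mulVecF Γ (wStar b (tmulVecF Γ Y) g)) Z}).toReal

/-- The chi-squared distribution with `k` degrees of freedom, realized as the law of the sum of
squares of `k` independent standard Gaussians. -/
def chiSq (k : ℕ) : Measure ℝ :=
  Measure.map (fun g : Fin k → ℝ => ∑ i, g i ^ 2) (stdGaussianPi k)

/-- The quantile function of the chi-squared distribution with `k` degrees of freedom. -/
def chiSqQuantile (k : ℕ) (p : ℝ) : ℝ :=
  sInf {x : ℝ | ENNReal.ofReal p ≤ chiSq k (Set.Iic x)}

end PPT

namespace PPTaux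

/-- Super-uniformity of the upper-tail p-value. -/
lemma super_uniform {Ω : Type*} [MeasurableSpace Ω] (P : Measure Ω) [IsProbabilityMeasure P]
    (s : Ω → ℝ) (hs : Measurable s) (a : ENNReal) :
    P {x | P {y | s x ≤ s y} ≤ a} ≤ a := by
  set Q := P.map s with hQ
  have hQp : IsProbabilityMeasure Q := Measure.isProbabilityMeasure_map hs.aemeasurable
  have h1 : ∀ t, P {y | t ≤ s y} = Q (Set.Ici t) := fun t => by
    rw [hQ, Measure.map_apply hs measurableSet_Ici]; rfl
  set U : Set ℝ := {t | Q (Set.Ici t) ≤ a} with hU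
  have hup : IsUpperSet U := fun t t' htt ht =>
    le_trans (measure_mono (Set.Ici_subset_Ici.2 htt)) ht
  have hUm : MeasurableSet U := hup.ordConnected.measurableSet
  have : P {x | P {y | s x ≤ s y} ≤ a} = Q U := by
    rw [hQ, Measure.map_apply hs hUm]
    simp only [h1]; rfl
  rw [this, hUm.measure_eq_iSup_isCompact]
  refine iSup₂_le fun K hKU => iSup_le fun hK => ?_
  rcases K.eq_empty_or_nonempty with rfl | hne
  · simp
  · obtain ⟨t, ht⟩ := hK.exists_isLeast hne
    exact le_trans (measure_mono fun x hx => ht.2 hx) (hKU ht.1)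

/-- Abstract validity of a randomization p-value. -/
lemma abstract_valid {Ω E : Type*} [MeasurableSpace Ω] [MeasurableSpace E]
    (P : Measure Ω) [IsProbabilityMeasure P] (ν : Measure E) [IsProbabilityMeasure ν]
    (A : E × Ω → E) (hA : Measurable A) (hinv : (ν.prod P).map A = ν)
    (S : E → ℝ) (hS : Measurable S)
    (hcomp : ∀ w, ∀ᵐ g ∂P,
      P {h | S (A (w, g)) ≤ S (A (A (w, g), h))} = P {h | S (A (w, g)) ≤ S (A (w, h))})
    (a : ENNReal) :
    ν {w | P {h | S w ≤ S (A (w, h))} ≤ a} ≤ a := by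
  have hm : Measurable fun w => P {h | S w ≤ S (A (w, h))} := by
    have : MeasurableSet {p : E × Ω | S p.1 ≤ S (A p)} :=
      measurableSet_le (by fun_prop) (by fun_prop)
    exact measurable_measure_prodMk_left this
  have hB : MeasurableSet {w | P {h | S w ≤ S (A (w, h))} ≤ a} :=
    measurableSet_le hm measurable_const
  conv_lhs => rw [← hinv]
  rw [Measure.map_apply hA hB, Measure.prod_apply (hA hB)]
  calc _ ≤ ∫⁻ w, a ∂ν := by
        refine lintegral_mono fun w => ?_
        refine le_trans (le_of_eq ?_) (super_uniform P (fun g => S (A (w, g))) (by fun_prop) a)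
        refine measure_congr ?_
        filter_upwards [hcomp w] with g hg
        change (_ ≤ a) = (_ ≤ a)
        rw [hg]
    _ = a := by simp

section polar
variable {ι : Type*} [Fintype ι]

def gpi (ι : Type*) [Fintype ι] : Measure (ι → ℝ) := Measure.pi fun _ => gaussianReal 0 1

instance : IsProbabilityMeasure (gpi ι) := by unfold gpi; infer_instance

def N (x : ι → ℝ) : ℝ := Real.sqrt (∑ i, x i ^ 2)

def rho (k : ℕ) (r : ℝ) : ENNReal :=
  ENNReal.ofReal ((Real.sqrt (2 * Real.pi))⁻¹ ^ k * Real.exp (- r ^ 2 / 2))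

@[fun_prop]
lemma measurable_rho (k : ℕ) : Measurable (rho k) := by unfold rho; fun_prop

@[fun_prop]
lemma measurable_N : Measurable (N : (ι → ℝ) → ℝ) := by unfold N; fun_prop

lemma N_nonneg (x : ι → ℝ) : 0 ≤ N x := Real.sqrt_nonneg _

lemma N_pos {x : ι → ℝ} (hx : x ≠ 0) : 0 < N x := by
  obtain ⟨i, hi⟩ := Function.ne_iff.1 hx
  refine Real.sqrt_pos.2 (Finset.sum_pos' (fun j _ => sq_nonneg _) ⟨i, Finset.mem_univ _, ?_⟩)
  have : x i ≠ 0 := hi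
  positivity

lemma N_smul {r : ℝ} (hr : 0 ≤ r) (x : ι → ℝ) : N (r • x) = r * N x := by
  simp only [N, Pi.smul_apply, smul_eq_mul, mul_pow, ← Finset.mul_sum]
  rw [Real.sqrt_mul (sq_nonneg r), Real.sqrt_sq hr]

lemma gpi_eq : gpi ι = (volume : Measure (ι → ℝ)).withDensity
    fun x => rho (Fintype.card ι) (N x) := by
  have hd : ∀ x : ι → ℝ, rho (Fintype.card ι) (N x)
      = ENNReal.ofReal (∏ i, gaussianPDFReal 0 1 (x i)) := by
    intro x
    simp only [rho, N, gaussianPDFReal, Finset.prod_mul_distrib, Finset.prod_const,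
      Finset.card_univ, ← Real.exp_sum]
    rw [Real.sq_sqrt (Finset.sum_nonneg fun i _ => sq_nonneg _)]
    simp [Finset.sum_div, neg_div]
  simp only [hd]
  symm
  unfold gpi
  refine (Measure.pi_eq fun s hs => ?_).symm
  rw [withDensity_apply _ (MeasurableSet.univ_pi hs), volume_pi, Measure.restrict_pi_pi,
    ← ofReal_integral_eq_lintegral_ofReal, integral_fintype_prod_eq_prod,
    ENNReal.ofReal_prod_of_nonneg]
  · refine Finset.prod_congr rfl fun i _ => ?_
    rw [gaussianReal_apply_eq_integral _ (by simp)]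
  · intro i _
    exact integral_nonneg fun x => gaussianPDFReal_nonneg _ _ _
  · exact Integrable.fintype_prod (fun i => (integrable_gaussianPDFReal 0 1).restrict)
  · exact Eventually.of_forall fun x => Finset.prod_nonneg fun i _ => gaussianPDFReal_nonneg _ _ _

lemma scale {r : ℝ} (hr : 0 < r) {f : (ι → ℝ) → ENNReal} (hf : Measurable f) :
    ∫⁻ x, f x = ENNReal.ofReal (r ^ Fintype.card ι) * ∫⁻ x, f (r • x) := by
  have h := Measure.map_addHaar_smul (volume : Measure (ι → ℝ)) hr.ne'
  have h2 : ∫⁻ x, f (r • x) = ∫⁻ x, f x ∂(Measure.map (r • ·) (volume : Measure (ι → ℝ))) := by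
    rw [lintegral_map hf (by fun_prop)]
  rw [h2, h, lintegral_smul_measure, smul_eq_mul, ← mul_assoc, ← ENNReal.ofReal_mul (by positivity)]
  rw [Module.finrank_fintype_fun_eq_card, abs_of_pos (by positivity),
    mul_inv_cancel₀ (by positivity)]
  simp

lemma polar_lintegral [Nonempty ι] : ∃ C : ENNReal, ∀ f : (ι → ℝ) → ENNReal, Measurable f →
    ∫⁻ x, ∫⁻ y, f ((N x / N y) • y) ∂(gpi ι) ∂(gpi ι) = C * ∫⁻ x, f x ∂(gpi ι) := by
  set k := Fintype.card ι with hk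
  refine ⟨∫⁻ u : ι → ℝ, ENNReal.ofReal (((N u) ^ k)⁻¹) * ENNReal.ofReal (((N u) ^ k)⁻¹)
    * rho k (N u)⁻¹, fun f hf => ?_⟩
  have hne : ∀ᵐ x : ι → ℝ, x ≠ 0 := by
    simp [ae_iff]
  rw [gpi_eq, lintegral_withDensity_eq_lintegral_mul _ (by fun_prop) hf,
    lintegral_withDensity_eq_lintegral_mul _ (by fun_prop)]
  swap
  · apply Measurable.lintegral_prod_right
    fun_prop
  simp only [Pi.mul_apply]
  calc ∫⁻ x, rho k (N x) * ∫⁻ y, f ((N x / N y) • y)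
        ∂(volume.withDensity fun x => rho k (N x))
      = ∫⁻ x, ∫⁻ y, rho k (N x) * (rho k (N y) * f ((N x / N y) • y)) := by
        refine lintegral_congr fun x => ?_
        rw [lintegral_withDensity_eq_lintegral_mul _ (by fun_prop) (by fun_prop),
          lintegral_const_mul _ (by fun_prop)]
        rfl
    _ = ∫⁻ y, ∫⁻ x, rho k (N x) * (rho k (N y) * f ((N x / N y) • y)) := by
        apply lintegral_lintegral_swap
        fun_prop
    _ = ∫⁻ y, ∫⁻ z, ENNReal.ofReal (N y ^ k) * (rho k (N y * N z) * (rho k (N y) * f (N z • y))) := by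
        refine lintegral_congr_ae ?_
        filter_upwards [hne] with y hy
        have hy' := N_pos hy
        rw [scale hy' (by fun_prop), ← lintegral_const_mul _ (by fun_prop)]
        refine lintegral_congr fun z => ?_
        rw [N_smul hy'.le, mul_div_cancel_left₀ _ hy'.ne']
    _ = ∫⁻ z, ∫⁻ y, ENNReal.ofReal (N y ^ k) * (rho k (N y * N z) * (rho k (N y) * f (N z • y))) := by
        apply lintegral_lintegral_swap
        fun_prop
    _ = ∫⁻ z, ∫⁻ v, ENNReal.ofReal ((N z)⁻¹ ^ k) * (ENNReal.ofReal (((N z)⁻¹ * N v) ^ k) *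
          (rho k (N v) * (rho k ((N z)⁻¹ * N v) * f v))) := by
        refine lintegral_congr_ae ?_
        filter_upwards [hne] with z hz
        have hz' := N_pos hz
        rw [scale (inv_pos.2 hz') (by fun_prop), ← lintegral_const_mul _ (by fun_prop)]
        refine lintegral_congr fun v => ?_
        rw [N_smul (inv_pos.2 hz').le, smul_smul, mul_inv_cancel₀ hz'.ne', one_smul]
        congr 4
        field_simp
    _ = ∫⁻ v, ∫⁻ z, ENNReal.ofReal ((N z)⁻¹ ^ k) * (ENNReal.ofReal (((N z)⁻¹ * N v) ^ k) *
          (rho k (N v) * (rho k ((N z)⁻¹ * N v) * f v))) := by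
        apply lintegral_lintegral_swap
        fun_prop
    _ = ∫⁻ v, (∫⁻ u : ι → ℝ, ENNReal.ofReal (((N u) ^ k)⁻¹) * ENNReal.ofReal (((N u) ^ k)⁻¹)
          * rho k (N u)⁻¹) * (rho k (N v) * f v) := by
        refine lintegral_congr_ae ?_
        filter_upwards [hne] with v hv
        have hv' := N_pos hv
        rw [scale hv' (by fun_prop), ← lintegral_const_mul _ (by fun_prop),
          ← lintegral_mul_const _ (by fun_prop)]
        refine lintegral_congr_ae ?_
        filter_upwards [hne] with u hu
        have hu' := N_pos hu
        rw [N_smul hv'.le]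
        have e1 : (N v * N u)⁻¹ * N v = (N u)⁻¹ := by field_simp
        rw [e1]
        have e2 : ENNReal.ofReal (N v ^ k) * ENNReal.ofReal ((N v * N u)⁻¹ ^ k)
            = ENNReal.ofReal ((N u ^ k)⁻¹) := by
          rw [← ENNReal.ofReal_mul (by positivity)]
          congr 1
          rw [← inv_pow, ← mul_pow]
          congr 1
          field_simp
        rw [← mul_assoc, e2, inv_pow]
        ring
    _ = _ := by
        rw [lintegral_const_mul _ (by fun_prop)]

lemma polar_map [Nonempty ι] :
    ((gpi ι).prod (gpi ι)).map (fun p => (N p.1 / N p.2) • p.2) = gpi ι := by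
  obtain ⟨C, hC⟩ := polar_lintegral (ι := ι)
  have h1 := hC (fun _ => 1) measurable_const
  simp at h1
  have hm : Measurable fun p : (ι → ℝ) × (ι → ℝ) => (N p.1 / N p.2) • p.2 := by fun_prop
  refine Measure.ext fun s hs => ?_
  have := hC (s.indicator 1) (measurable_one.indicator hs)
  rw [lintegral_indicator_one hs, ← h1, one_mul] at this
  rw [← this, ← lintegral_indicator_one hs, lintegral_map (measurable_one.indicator hs) hm]
  exact lintegral_prod _ ((measurable_one.indicator hs).comp hm).aemeasurable

end polar
end PPTaux

namespace PPTaux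
open PPT

lemma gpi_fin (n : ℕ) : stdGaussianPi n = gpi (Fin n) := rfl

lemma tailNormSq_eq {n : ℕ} (b : ℕ) (w : Fin n → ℝ) :
    Real.sqrt (tailNormSq b w) =
      N (fun i : {i : Fin n // ¬ ((i : ℕ) < n - b)} => w i) := by
  unfold tailNormSq N
  congr 1
  rw [← Finset.sum_subtype (p := fun i : Fin n => ¬ ((i : ℕ) < n - b))
    (Finset.univ.filter (fun i : Fin n => n - b ≤ (i : ℕ))) (by simp) (fun i => w i ^ 2)]

lemma measurable_wStar {n : ℕ} (b : ℕ) :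
    Measurable fun p : (Fin n → ℝ) × (Fin n → ℝ) => wStar b p.1 p.2 := by
  refine measurable_pi_lambda _ fun i => ?_
  unfold wStar tailNormSq
  split_ifs <;> fun_prop

lemma wStar_mp {n b : ℕ} (hn : 1 ≤ n) (hb : 1 ≤ b) :
    MeasurePreserving (fun p : (Fin n → ℝ) × (Fin n → ℝ) => wStar b p.1 p.2)
      ((gpi (Fin n)).prod (gpi (Fin n))) (gpi (Fin n)) := by
  let q : Fin n → Prop := fun i => (i : ℕ) < n - b
  have : Nonempty {i // ¬ q i} := ⟨⟨⟨n - 1, by omega⟩, by simp only [q]; omega⟩⟩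
  have he : MeasurePreserving (MeasurableEquiv.piEquivPiSubtypeProd (fun _ : Fin n => ℝ) q)
      (gpi (Fin n)) ((gpi {i // q i}).prod (gpi {i // ¬ q i})) :=
    measurePreserving_piEquivPiSubtypeProd (fun _ => gaussianReal 0 1) q
  have hpol : MeasurePreserving
      (fun p : ({i // ¬ q i} → ℝ) × ({i // ¬ q i} → ℝ) => (N p.1 / N p.2) • p.2)
      ((gpi {i // ¬ q i}).prod (gpi {i // ¬ q i})) (gpi {i // ¬ q i}) :=
    ⟨by fun_prop, polar_map⟩
  have h1 := he.prod (measurePreserving_snd.comp he)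
  have h2 := (measurePreserving_prodAssoc (gpi {i // q i}) (gpi {i // ¬ q i})
    (gpi {i // ¬ q i})).comp h1
  have h3 := ((MeasurePreserving.id (gpi {i // q i})).prod hpol).comp h2
  have h4 := (he.symm).comp h3
  convert h4 using 1
  funext p i
  by_cases hi : (i : ℕ) < n - b
  · simp [wStar, MeasurableEquiv.piEquivPiSubtypeProd, Equiv.piEquivPiSubtypeProd, q, hi]
    rfl
  · simp only [wStar, tailNormSq_eq]
    simp [MeasurableEquiv.piEquivPiSubtypeProd, Equiv.piEquivPiSubtypeProd, q, hi]
    exact mul_div_right_comm _ _ _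

lemma perm_mp {n : ℕ} (ψ : Equiv.Perm (Fin n)) :
    MeasurePreserving (fun w : Fin n → ℝ => w ∘ ψ) (gpi (Fin n)) (gpi (Fin n)) := by
  have h := measurePreserving_piCongrLeft (fun _ : Fin n => gaussianReal 0 1) ψ.symm
  change MeasurePreserving _ (gpi (Fin n)) (gpi (Fin n)) at h
  convert h using 1
  funext w i
  have := MeasurableEquiv.piCongrLeft_apply_apply (β := fun _ : Fin n => ℝ) ψ.symm w (ψ i)
  simpa using this.symm

lemma rot_mp {n : ℕ} (Γ : Fin n → Fin n → ℝ) (h : IsOrthogonalF Γ) :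
    MeasurePreserving (tmulVecF Γ) (gpi (Fin n)) (gpi (Fin n)) := by
  let M : Matrix (Fin n) (Fin n) ℝ := Matrix.of Γ
  have hM : M * M.transpose = 1 := by
    ext i j
    simp [Matrix.mul_apply, M, h i j, Matrix.one_apply]
  have hM' : M.transpose * M = 1 := mul_eq_one_comm.1 hM
  have hfun : tmulVecF Γ = Matrix.toLin' M.transpose := by
    funext v i
    simp [tmulVecF, Matrix.mulVec, dotProduct, M]
  have hN : ∀ v, N (tmulVecF Γ v) = N v := by
    intro v
    have : ∀ u : Fin n → ℝ, ∑ i, u i ^ 2 = dotProduct u u := fun u => by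
      simp [dotProduct, sq]
    unfold N
    rw [this, this, hfun]
    simp only [Matrix.toLin'_apply]
    rw [Matrix.dotProduct_mulVec, Matrix.vecMul_transpose, Matrix.mulVec_mulVec, hM,
      Matrix.one_mulVec]
  have hdet2 : M.transpose.det * M.transpose.det = 1 := by
    have := congrArg Matrix.det hM
    rwa [Matrix.det_mul, ← Matrix.det_transpose M, Matrix.det_one] at this
  have hdet : |M.transpose.det| = 1 := by
    rw [← sq_eq_sq₀ (abs_nonneg _) zero_le_one, sq_abs, sq, hdet2, one_pow]
  have hvol : Measure.map (tmulVecF Γ) (volume : Measure (Fin n → ℝ)) = volume := by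
    rw [hfun, Real.map_matrix_volume_pi_eq_smul_volume_pi (by
      intro h0; rw [h0] at hdet; simp at hdet)]
    rw [abs_inv, hdet]; simp
  have hm : Measurable (tmulVecF Γ) := by
    refine measurable_pi_lambda _ fun i => ?_
    unfold tmulVecF; fun_prop
  refine ⟨hm, Measure.ext fun s hs => ?_⟩
  rw [Measure.map_apply hm hs, gpi_eq, withDensity_apply _ hs, withDensity_apply _ (hm hs)]
  conv_rhs => rw [← hvol]
  rw [setLIntegral_map hs (by fun_prop) hm]
  simp only [hN]

lemma tail_zero {n d b : ℕ} (X : Fin n → Fin d → ℝ) (β0 : ℝ) (β : Fin d → ℝ)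
    (Kn : Fin n → Fin n → ℝ) (hKn : ∀ i j, Kn i j = 1 + ∑ k, X i k * X j k)
    (Γ : Fin n → Fin n → ℝ) (c : Fin n → ℝ) (hEig : IsEigenDecomp Kn Γ c)
    (hb1 : 1 ≤ b) (hb2 : b ≤ n - (d + 1)) (i : Fin n) (hi : ¬ (i : ℕ) < n - b) :
    tmulVecF Γ (fun j => β0 + ∑ k, β k * X j k) i = 0 := by
  obtain ⟨hO, hK, hc, -⟩ := hEig
  let M : Matrix (Fin n) (Fin n) ℝ := Matrix.of Γ
  have hM : M * M.transpose = 1 := by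
    ext i j
    simp [Matrix.mul_apply, M, hO i j, Matrix.one_apply]
  have hM' : M.transpose * M = 1 := mul_eq_one_comm.1 hM
  let F : Matrix (Fin n) (Option (Fin d)) ℝ := Matrix.of fun i a => a.elim 1 (X i)
  have hKF : M * Matrix.diagonal c * M.transpose = F * F.transpose := by
    ext i j
    have := hK i j
    rw [hKn] at this
    rw [Matrix.mul_apply, Matrix.mul_apply]
    simp only [Matrix.mul_diagonal, Matrix.transpose_apply, Fintype.sum_option]
    simp only [M, F, Matrix.of_apply, Option.elim]
    rw [← this]; ring
  set R := M.transpose * F with hR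
  have hD : Matrix.diagonal c = R * R.transpose := by
    calc Matrix.diagonal c = (M.transpose * M) * Matrix.diagonal c * (M.transpose * M) := by
          rw [hM']; simp
      _ = M.transpose * (M * Matrix.diagonal c * M.transpose) * M := by
          simp only [Matrix.mul_assoc]
      _ = R * R.transpose := by
          rw [hKF, hR, Matrix.transpose_mul, Matrix.transpose_transpose]
          simp only [Matrix.mul_assoc]
  have hrank : Fintype.card {i // c i ≠ 0} ≤ d + 1 := by
    rw [← Matrix.rank_diagonal, hD]
    refine (Matrix.rank_mul_le_left _ _).trans ((Matrix.rank_le_card_width _).trans ?_)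
    simp
  have hci : c i = 0 := by
    by_contra hne
    have hnn : ∀ j, 0 ≤ c j := by
      intro j
      have := congrFun (congrFun hD j) j
      rw [Matrix.diagonal_apply_eq, Matrix.mul_apply] at this
      rw [this]
      exact Finset.sum_nonneg fun a _ => mul_self_nonneg _
    have hpos : 0 < c i := lt_of_le_of_ne (hnn i) (Ne.symm hne)
    have hle : Fintype.card (Fin (i + 1)) ≤ Fintype.card {i // c i ≠ 0} :=
      Fintype.card_le_of_injective
        (fun j : Fin (i + 1) => (⟨⟨j, by omega⟩,
          (lt_of_lt_of_le hpos (hc _ _ (by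
            rw [Fin.le_def]; simp only; omega))).ne'⟩ : {i // c i ≠ 0}))
        (fun j j' h => by
          simp only [Subtype.mk.injEq, Fin.mk.injEq] at h
          exact Fin.ext h)
    rw [Fintype.card_fin] at hle
    omega
  have hRi : ∀ a, R i a = 0 := by
    have := congrFun (congrFun hD i) i
    rw [Matrix.diagonal_apply_eq, Matrix.mul_apply, hci] at this
    have h2 := (Finset.sum_eq_zero_iff_of_nonneg
      (fun a _ => mul_self_nonneg (R i a))).1 this.symm
    intro a
    exact mul_self_eq_zero.1 (h2 a (Finset.mem_univ _))
  have h0 : ∑ j, Γ j i = 0 := by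
    have := hRi none
    simpa [hR, Matrix.mul_apply, M, F] using this
  have hk : ∀ k, ∑ j, Γ j i * X j k = 0 := by
    intro k
    have := hRi (some k)
    simpa [hR, Matrix.mul_apply, M, F] using this
  simp only [tmulVecF, mul_add, Finset.sum_add_distrib, ← Finset.sum_mul, h0, zero_mul, zero_add,
    Finset.mul_sum]
  rw [Finset.sum_comm]
  refine Finset.sum_eq_zero fun k _ => ?_
  have : ∀ j, Γ j i * (β k * X j k) = β k * (Γ j i * X j k) := fun j => by ring
  simp only [this, ← Finset.mul_sum, hk, mul_zero]

lemma noise_eq (n : ℕ) (σ : ℝ) :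
    noiseLaw n σ = (gpi (Fin n)).map (fun g i => σ * g i) := by
  unfold noiseLaw gpi
  have h : (gaussianReal 0 1).map (fun x => σ * x) = gaussianReal 0 ((σ ^ 2).toNNReal) := by
    rw [gaussianReal_map_const_mul]
    congr 1
    · simp
    · ext; simp [sq_nonneg]
  have : SigmaFinite ((gaussianReal 0 1).map (fun x => σ * x)) := by rw [h]; infer_instance
  rw [Measure.pi_map_pi (f := fun _ x => σ * x) (fun i => by fun_prop)]
  simp only [h]

lemma tailNormSq_wStar {n : ℕ} (b : ℕ) (w g : Fin n → ℝ) (hg : tailNormSq b g ≠ 0) :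
    tailNormSq b (wStar b w g) = tailNormSq b w := by
  have hnn : ∀ u : Fin n → ℝ, 0 ≤ tailNormSq b u := fun u =>
    Finset.sum_nonneg fun i _ => sq_nonneg _
  have : tailNormSq b (wStar b w g) = ∑ i ∈ Finset.univ.filter (fun i : Fin n => n - b ≤ (i : ℕ)),
      (tailNormSq b w / tailNormSq b g) * g i ^ 2 := by
    conv_lhs => unfold tailNormSq
    refine Finset.sum_congr rfl fun i hi => ?_
    have hi' : ¬ (i : ℕ) < n - b := by simpa using hi
    rw [wStar, if_neg hi', div_pow, mul_pow, Real.sq_sqrt (hnn _), Real.sq_sqrt (hnn _)]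
    ring
  rw [this, ← Finset.mul_sum]
  exact div_mul_cancel₀ _ hg

lemma wStar_wStar {n : ℕ} (b : ℕ) (w g h : Fin n → ℝ) (hg : tailNormSq b g ≠ 0) :
    wStar b (wStar b w g) h = wStar b w h := by
  funext i
  unfold wStar
  split_ifs with hi
  · rfl
  · have := tailNormSq_wStar b w g hg
    unfold wStar at this
    rw [this]

lemma ae_tail_ne {n b : ℕ} (hn : 1 ≤ n) (hb : 1 ≤ b) :
    ∀ᵐ g ∂(gpi (Fin n)), tailNormSq b g ≠ 0 := by
  let i : Fin n := ⟨n - 1, by omega⟩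
  have hmp : MeasurePreserving (Function.eval i) (gpi (Fin n)) (gaussianReal 0 1) :=
    measurePreserving_eval (fun _ => gaussianReal 0 1) i
  have := nullSingletonClass_gaussianReal (μ := 0) (v := 1) one_ne_zero
  have h0 : ∀ᵐ x ∂(gaussianReal 0 1), x ≠ 0 := by simp [ae_iff]
  filter_upwards [hmp.quasiMeasurePreserving.ae h0] with g hg h
  have := (Finset.sum_eq_zero_iff_of_nonneg (fun j _ => sq_nonneg (g j))).1 h i (by
    simp [i]; omega)
  exact hg (by simpa using this)

/-- The affine image of the standard Gaussian law. -/
def aff {n : ℕ} (m : Fin n → ℝ) (σ : ℝ) (g : Fin n → ℝ) : Fin n → ℝ := fun i => m i + σ * g i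

@[fun_prop]
lemma measurable_aff {n : ℕ} (m : Fin n → ℝ) (σ : ℝ) : Measurable (aff m σ) := by
  unfold aff; fun_prop

lemma wStar_aff {n b : ℕ} (m : Fin n → ℝ) (σ : ℝ) (hσ : 0 < σ)
    (hm : ∀ i : Fin n, ¬ (i : ℕ) < n - b → m i = 0) (w g : Fin n → ℝ) :
    wStar b (aff m σ w) g = aff m σ (wStar b w g) := by
  have ht : tailNormSq b (aff m σ w) = σ ^ 2 * tailNormSq b w := by
    unfold tailNormSq
    rw [Finset.mul_sum]
    refine Finset.sum_congr rfl fun i hi => ?_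
    rw [aff, hm i (by simpa using hi)]
    ring
  funext i
  unfold wStar
  by_cases hi : (i : ℕ) < n - b
  · simp [aff, hi]
  · rw [ht, Real.sqrt_mul (sq_nonneg σ), Real.sqrt_sq hσ.le]
    simp only [aff, hi, if_false, hm i hi]
    ring

lemma aff_perm {n b : ℕ} (m : Fin n → ℝ) (σ : ℝ)
    (hm : ∀ i : Fin n, ¬ (i : ℕ) < n - b → m i = 0) (w : Fin n → ℝ)
    (ψ : Equiv.Perm (Fin n)) (hψ : ψ ∈ permSet n b) :
    aff m σ w ∘ ψ = aff m σ (w ∘ ψ) := by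
  have h : ∀ i : Fin n, (i : ℕ) < n - b → ψ i = i := by simpa [permSet] using hψ
  funext i
  simp only [aff, Function.comp]
  congr 1
  by_cases hi : (i : ℕ) < n - b
  · rw [h i hi]
  · rw [hm i hi]
    apply hm
    intro hlt
    have := ψ.injective (h _ hlt)
    rw [this] at hlt
    exact hi hlt

lemma cont_valid {n b : ℕ} (hn : 1 ≤ n) (hb : 1 ≤ b) (m : Fin n → ℝ) (σ : ℝ) (hσ : 0 < σ)
    (hm : ∀ i : Fin n, ¬ (i : ℕ) < n - b → m i = 0)
    (S : (Fin n → ℝ) → ℝ) (hS : Measurable S) (a : ENNReal) :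
    ((gpi (Fin n)).map (aff m σ)) {w | gpi (Fin n) {g | S w ≤ S (wStar b w g)} ≤ a} ≤ a := by
  have : IsProbabilityMeasure ((gpi (Fin n)).map (aff m σ)) :=
    Measure.isProbabilityMeasure_map (by fun_prop)
  refine abstract_valid (gpi (Fin n)) _ (fun p => wStar b p.1 p.2) (measurable_wStar b) ?_ S hS ?_ a
  · have h1 : MeasurePreserving (aff m σ) (gpi (Fin n)) ((gpi (Fin n)).map (aff m σ)) :=
      ⟨by fun_prop, rfl⟩
    have h2 := h1.prod (MeasurePreserving.id (gpi (Fin n)))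
    have h3 := h1.comp (wStar_mp hn hb)
    rw [← h2.map_eq, Measure.map_map (measurable_wStar b) h2.measurable, ← h3.map_eq]
    congr 1
    funext p
    exact wStar_aff m σ hσ hm p.1 p.2
  · intro w
    filter_upwards [ae_tail_ne hn hb] with g hg
    simp only [wStar_wStar b w g _ hg]

lemma permSet_nonempty (n b : ℕ) : (permSet n b).Nonempty := ⟨1, by simp [permSet]⟩

lemma permSet_mul {n b : ℕ} {ψ : Equiv.Perm (Fin n)} (hψ : ψ ∈ permSet n b)
    (φ : Equiv.Perm (Fin n)) : ψ * φ ∈ permSet n b ↔ φ ∈ permSet n b := by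
  simp only [permSet, Finset.mem_filter, Finset.mem_univ, true_and] at *
  refine forall₂_congr fun i hi => ?_
  rw [Equiv.Perm.mul_apply]
  constructor
  · intro h
    exact ψ.injective (h.trans (hψ i hi).symm)
  · intro h
    rw [h, hψ i hi]

/-- Proportion of permutations in `M(n,b)` satisfying a predicate. -/
lemma disc_valid {n b : ℕ} (m : Fin n → ℝ) (σ : ℝ)
    (hm : ∀ i : Fin n, ¬ (i : ℕ) < n - b → m i = 0)
    (S : (Fin n → ℝ) → ℝ) (hS : Measurable S) (a : ENNReal) :
    ((gpi (Fin n)).map (aff m σ)) {w |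
      (((permSet n b).filter (fun ψ : Equiv.Perm (Fin n) => S w ≤ S (w ∘ ψ))).card : ENNReal) / (permSet n b).card ≤ a}
      ≤ a := by
  classical
  have : IsProbabilityMeasure ((gpi (Fin n)).map (aff m σ)) :=
    Measure.isProbabilityMeasure_map (by fun_prop)
  let : MeasurableSpace (Equiv.Perm (Fin n)) := ⊤
  have : DiscreteMeasurableSpace (Equiv.Perm (Fin n)) := ⟨fun _ => trivial⟩
  let P : Measure (Equiv.Perm (Fin n)) := uniformOn (permSet n b : Set (Equiv.Perm (Fin n)))
  have hP : IsProbabilityMeasure P :=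
    isProbabilityMeasure_uniformOn (Finset.finite_toSet _) (permSet_nonempty n b)
  have hPa : ∀ q : Equiv.Perm (Fin n) → Prop, P {ψ | q ψ} =
      (((permSet n b).filter q).card : ENNReal) / (permSet n b).card := by
    intro q
    have : {ψ | q ψ} = ((Finset.univ.filter q : Finset (Equiv.Perm (Fin n))) : Set _) := by
      ext; simp
    rw [this, uniformOn_apply_finset]
    congr 3
    ext; simp
  have hae : ∀ᵐ ψ ∂P, ψ ∈ permSet n b := by
    rw [ae_iff, hPa]
    simp
  have hAm : Measurable fun p : (Fin n → ℝ) × Equiv.Perm (Fin n) => p.1 ∘ p.2 := by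
    refine measurable_from_prod_countable_left fun ψ => ?_
    exact (perm_mp ψ).measurable
  have key := abstract_valid P ((gpi (Fin n)).map (aff m σ)) (fun p => p.1 ∘ p.2) hAm ?_ S hS ?_ a
  · simpa only [hPa] using key
  · refine Measure.ext fun B hB => ?_
    rw [Measure.map_apply hAm hB, Measure.prod_apply_symm (hAm hB)]
    calc _ = ∫⁻ ψ, ((gpi (Fin n)).map (aff m σ)) B ∂P := by
          refine lintegral_congr_ae ?_
          filter_upwards [hae] with ψ hψ
          have h1 : MeasurePreserving (aff m σ) (gpi (Fin n)) ((gpi (Fin n)).map (aff m σ)) :=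
            ⟨by fun_prop, rfl⟩
          have h2 := h1.comp (perm_mp ψ)
          have h3 : ((gpi (Fin n)).map (aff m σ)).map (fun w => w ∘ ψ)
              = (gpi (Fin n)).map (aff m σ) := by
            conv_rhs => rw [← h2.map_eq]
            rw [Measure.map_map (perm_mp ψ).measurable (by fun_prop)]
            congr 1
            funext w
            exact aff_perm m σ hm w ψ hψ
          conv_rhs => rw [← h3]
          rw [Measure.map_apply (perm_mp ψ).measurable hB]
          rfl
      _ = _ := by simp
  · intro w
    filter_upwards [hae] with ψ hψ
    rw [hPa, hPa]
    congr 2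
    refine Finset.card_bij (fun φ _ => ψ * φ) ?_ ?_ ?_
    · intro φ hφ
      rw [Finset.mem_filter] at hφ ⊢
      exact ⟨(permSet_mul hψ φ).2 hφ.1, hφ.2⟩
    · intro φ _ φ' _ h
      exact mul_left_cancel h
    · intro φ hφ
      rw [Finset.mem_filter] at hφ
      refine ⟨ψ⁻¹ * φ, ?_, by simp⟩
      rw [Finset.mem_filter]
      have e : ψ * (ψ⁻¹ * φ) = φ := by simp
      refine ⟨(permSet_mul hψ _).1 (by rw [e]; exact hφ.1), ?_⟩
      have e2 : (w ∘ ψ) ∘ (ψ⁻¹ * φ : Equiv.Perm (Fin n)) = w ∘ φ := by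
        conv_rhs => rw [← e]
        rfl
      rw [e2]; exact hφ.2

end PPTaux

open PPT in
/-- Theorem 1: validity of the discrete and continuous partial permutation
tests with the linear kernel, when the true regression function is affine and the noises are
i.i.d. centered Gaussian. -/
theorem partial_permutation_valid_linear
    {n d H : ℕ} (hn : 1 ≤ n) (hd : 1 ≤ d)
    (X : Fin n → Fin d → ℝ) (Z : Fin n → Fin H)
    -- the true functional relationship is affine
    (f0 : (Fin d → ℝ) → ℝ) (β0 : ℝ) (β : Fin d → ℝ)
    (hf0 : ∀ x, f0 x = β0 + ∑ k, β k * x k)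
    -- noise level
    (σ0 : ℝ) (hσ0 : 0 < σ0)
    -- the law of Y = f0(X) + ε with ε ~ N(0, σ0² Iₙ)
    (μY : Measure (Fin n → ℝ))
    (hμY : μY = Measure.map (fun ε : Fin n → ℝ => fun i => f0 (X i) + ε i) (noiseLaw n σ0))
    -- sample kernel matrix of the linear kernel K(x,x') = 1 + xᵀx'
    (Kn : Fin n → Fin n → ℝ)
    (hKn : ∀ i j, Kn i j = 1 + ∑ k, X i k * X j k)
    -- a fixed eigendecomposition Kn = Γ diag(c) Γᵀ
    (Γ : Fin n → Fin n → ℝ) (c : Fin n → ℝ) (hEig : IsEigenDecomp Kn Γ c)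
    -- permutation size
    (b : ℕ) (hb1 : 1 ≤ b) (hb2 : b ≤ n - (d + 1))
    -- arbitrary (measurable) test statistic
    (T : (Fin n → Fin d → ℝ) → (Fin n → ℝ) → (Fin n → Fin H) → ℝ)
    (hT : Measurable fun y => T X y Z) :
    ∀ α ∈ Set.Ioo (0 : ℝ) 1,
      μY {y | pDisc X Z T Γ b y ≤ α} ≤ ENNReal.ofReal α ∧
      μY {y | pCont X Z T Γ b y ≤ α} ≤ ENNReal.ofReal α := by
  intro α hα
  have hO := hEig.1
  set m : Fin n → ℝ := tmulVecF Γ (fun j => f0 (X j)) with hm_def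
  have hm : ∀ i : Fin n, ¬ (i : ℕ) < n - b → m i = 0 := by
    intro i hi
    rw [hm_def]
    simp only [hf0]
    exact PPTaux.tail_zero X β0 β Kn hKn Γ c hEig hb1 hb2 i hi
  have hrot := PPTaux.rot_mp Γ hO
  have hlaw : μY.map (tmulVecF Γ) = (PPTaux.gpi (Fin n)).map (PPTaux.aff m σ0) := by
    conv_rhs => rw [← hrot.map_eq]
    rw [hμY, PPTaux.noise_eq, Measure.map_map hrot.measurable (by fun_prop),
      Measure.map_map (hrot.measurable.comp (by fun_prop)) (by fun_prop),
      Measure.map_map (by fun_prop) hrot.measurable]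
    congr 1
    funext g i
    simp only [Function.comp, tmulVecF, PPTaux.aff, hm_def, mul_add, Finset.sum_add_distrib,
      Finset.mul_sum]
    congr 1
    exact Finset.sum_congr rfl fun j _ => by ring
  have hinv : ∀ y, mulVecF Γ (tmulVecF Γ y) = y := by
    intro y
    funext i
    simp only [mulVecF, tmulVecF, Finset.mul_sum]
    rw [Finset.sum_comm]
    have : ∀ j, ∑ k, Γ i k * (Γ j k * y j) = (if i = j then (1 : ℝ) else 0) * y j := by
      intro j
      rw [← hO i j, Finset.sum_mul]
      exact Finset.sum_congr rfl fun k _ => by ring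
    simp [this]
  let S : (Fin n → ℝ) → ℝ := fun w => T X (mulVecF Γ w) Z
  have hS : Measurable S := by
    have : Measurable (mulVecF Γ) := by
      refine measurable_pi_lambda _ fun i => ?_
      unfold mulVecF; fun_prop
    exact hT.comp this
  have hSy : ∀ y, T X y Z = S (tmulVecF Γ y) := fun y => by simp only [S, hinv]
  have push : ∀ B : Set (Fin n → ℝ), μY (tmulVecF Γ ⁻¹' B) ≤ (PPTaux.gpi (Fin n)).map (PPTaux.aff m σ0) B := by
    intro B
    rw [← hlaw]
    exact Measure.le_map_apply hrot.measurable.aemeasurable B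
  constructor
  · refine le_trans ?_ (PPTaux.disc_valid (b := b) m σ0 hm S hS (ENNReal.ofReal α))
    refine le_trans (measure_mono ?_) (push _)
    intro y hy
    have hcard : (0 : ℝ) < (permSet n b).card := by
      exact_mod_cast (PPTaux.permSet_nonempty n b).card_pos
    simp only [Set.mem_ofPred_eq, pDisc, Finset.sum_boole] at hy
    simp only [Set.mem_preimage, Set.mem_ofPred_eq]
    rw [hSy] at hy
    rw [← ENNReal.ofReal_natCast, ← ENNReal.ofReal_natCast (permSet n b).card,
      ← ENNReal.ofReal_div_of_pos hcard]
    refine ENNReal.ofReal_le_ofReal ?_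
    rw [div_eq_inv_mul]
    exact hy
  · refine le_trans ?_ (PPTaux.cont_valid hn hb1 m σ0 hσ0 hm S hS (ENNReal.ofReal α))
    refine le_trans (measure_mono ?_) (push _)
    intro y hy
    simp only [Set.mem_ofPred_eq, pCont] at hy
    rw [hSy, PPTaux.gpi_fin] at hy
    simp only [Set.mem_preimage, Set.mem_ofPred_eq]
    rw [← ENNReal.ofReal_toReal (measure_ne_top (PPTaux.gpi (Fin n)) _)]
    exact ENNReal.ofReal_le_ofReal hy
end
end

section
/- Fix n ≥ 1, d ≥ 1, an integer p ≥ 1, a covariate matrix X ∈ ℝ^{n×d} with rows X_1,…,X_n, and group labels Z ∈ {1,…,H}ⁿ, and suppose Y = f₀(X) + ε, where f₀ is a polynomial in d variables of total degree at most p, f₀(X) = (f₀(X_1),…,f₀(X_n))ᵀ, and ε ~ N(0, σ₀² I_n) with σ₀ > 0. Then for the polynomial kernel K_Poly(x,x') = (1 + xᵀx')^p, any permutation size b with 1 ≤ b ≤ n − C(d+p, d) (where C(d+p,d) is the binomial coefficient), and any test statistic T, both the discrete and the continuous partial permutation p-values are valid: Pr(p(X,Y,Z) ≤ α) ≤ α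 for every α ∈ (0,1). -/
open MeasureTheory ProbabilityTheory Filter

noncomputable section

open PPT
open scoped ENNReal

theorem su_real (ν : Measure ℝ) (a : ℝ≥0∞) :
    ν {x | ν (Set.Ici x) ≤ a} ≤ a := by
  set A : Set ℝ := {x | ν (Set.Ici x) ≤ a} with hA
  have hup : ∀ x ∈ A, ∀ y, x ≤ y → y ∈ A := fun x hx y hxy =>
    (measure_mono (Set.Ici_subset_Ici.2 hxy)).trans hx
  by_cases hne : A.Nonempty
  swap
  · rw [Set.not_nonempty_iff_eq_empty] at hne
    rw [hne]; simp
  by_cases hbd : BddBelow A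
  · by_cases hm : sInf A ∈ A
    · have : A ⊆ Set.Ici (sInf A) := fun x hx => csInf_le hbd hx
      exact (measure_mono this).trans hm
    · obtain ⟨u, hu, hu1, hu2⟩ := exists_seq_tendsto_sInf hne hbd
      have : A ⊆ ⋃ n, Set.Ici (u n) := by
        intro x hx
        have hlt : sInf A < x := lt_of_le_of_ne (csInf_le hbd hx) (fun h => hm (h ▸ hx))
        obtain ⟨n, hn⟩ := (hu1.eventually (gt_mem_nhds hlt)).exists
        exact Set.mem_iUnion.2 ⟨n, hn.le⟩
      refine (measure_mono this).trans ?_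
      rw [Monotone.measure_iUnion]
      · exact iSup_le fun n => hu2 n
      · exact fun i j hij => Set.Ici_subset_Ici.2 (hu hij)
  · have : A ⊆ ⋃ n : ℕ, Set.Ici (-(n:ℝ)) := by
      intro x hx
      obtain ⟨n, hn⟩ := exists_nat_ge (-x)
      exact Set.mem_iUnion.2 ⟨n, by simp; linarith⟩
    refine (measure_mono this).trans ?_
    rw [Monotone.measure_iUnion]
    · refine iSup_le fun n => ?_
      rw [not_bddBelow_iff] at hbd
      obtain ⟨y, hy, hy'⟩ := hbd (-(n:ℝ))
      exact hup y hy _ hy'.le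
    · intro i j hij
      apply Set.Ici_subset_Ici.2
      simpa using hij

theorem su_gen {G : Type*} [MeasurableSpace G] (ν : Measure G) (s : G → ℝ) (hs : Measurable s)
    (a : ℝ≥0∞) : ν {g | ν {g' | s g ≤ s g'} ≤ a} ≤ a := by
  have h := su_real (ν.map s) a
  have h2 : ∀ x, (ν.map s) (Set.Ici x) = ν {g' | x ≤ s g'} := fun x => by
    rw [Measure.map_apply hs measurableSet_Ici]; rfl
  refine le_trans ?_ h
  refine le_trans ?_ (Measure.le_map_apply hs.aemeasurable _)
  refine measure_mono fun g hg => ?_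
  simpa [h2] using hg

theorem generic_valid {Ω G : Type*} [MeasurableSpace Ω] [MeasurableSpace G]
    (μ : Measure Ω) [IsProbabilityMeasure μ] (ν : Measure G) [IsProbabilityMeasure ν]
    (act : Ω → G → Ω) (hact : Measurable (fun q : Ω × G => act q.1 q.2))
    (h1 : (μ.prod ν).map (fun q : Ω × G => act q.1 q.2) = μ)
    (h2 : ∀ w, ∀ᵐ g ∂ν, ν.map (act (act w g)) = ν.map (act w))
    (S : Ω → ℝ) (hS : Measurable S) (a : ℝ≥0∞) :
    μ {w | ν {g | S w ≤ S (act w g)} ≤ a} ≤ a := by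
  have hm : Measurable (fun w => ν {g | S w ≤ S (act w g)}) :=
    measurable_measure_prodMk_left (s := {q : Ω × G | S q.1 ≤ S (act q.1 q.2)})
      (measurableSet_le (hS.comp measurable_fst) (hS.comp hact))
  have hms : MeasurableSet {w | ν {g | S w ≤ S (act w g)} ≤ a} := hm measurableSet_Iic
  have hw : ∀ w, Measurable (act w) := fun w => hact.comp measurable_prodMk_left
  conv_lhs => rw [← h1]
  rw [Measure.map_apply hact hms, Measure.prod_apply (hact hms)]
  calc _ ≤ ∫⁻ w, a ∂μ := by
        refine lintegral_mono fun w => ?_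
        refine le_trans (le_of_eq ?_) (su_gen ν (fun g => S (act w g)) (hS.comp (hw w)) a)
        refine measure_congr ?_
        filter_upwards [h2 w] with g hg
        apply propext
        have hset : MeasurableSet {v | S (act w g) ≤ S v} := measurableSet_le measurable_const hS
        have := congrArg (fun m => m {v | S (act w g) ≤ S v}) hg
        simp only [Measure.map_apply (hw _) hset] at this
        change ν {g' | S (act w g) ≤ S (act (act w g) g')} ≤ a ↔ _
        change ν {g' | S (act w g) ≤ S (act (act w g) g')} = ν {g' | S (act w g) ≤ S (act w g')} at this
        rw [this]; rfl
    _ = a := by simp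

theorem PPT.orth_col {n : ℕ} {Γ : Fin n → Fin n → ℝ} (h : IsOrthogonalF Γ) (i j : Fin n) :
    (∑ k, Γ k i * Γ k j) = if i = j then (1 : ℝ) else 0 := by
  have h1 : (Matrix.of Γ) * (Matrix.of Γ).transpose = 1 := by
    ext a b
    rw [Matrix.mul_apply, Matrix.one_apply, ← h a b]; rfl
  have h2 := mul_eq_one_comm.1 h1
  have := congrFun (congrFun h2 i) j
  rw [Matrix.mul_apply, Matrix.one_apply] at this
  exact this

theorem PPT.spec_aux {n : ℕ} {κ : Type*} [Fintype κ] (w : κ → ℝ) (hw : ∀ k, 0 < w k)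
    (m : κ → Fin n → ℝ) (Kn Γ : Fin n → Fin n → ℝ) (c : Fin n → ℝ)
    (hK : ∀ i j, Kn i j = ∑ k, w k * (m k i * m k j)) (hE : IsEigenDecomp Kn Γ c)
    (l : Fin n) (hl : Fintype.card κ ≤ l) (k : κ) : ∑ i, Γ i l * m k i = 0 := by
  classical
  obtain ⟨hO, hD, hmono, hc⟩ := hE
  have hO' := orth_col hO
  let u : Fin n → κ → ℝ := fun l k => ∑ i, Γ i l * m k i
  have H : ∀ a b, ∑ k, w k * (u a k * u b k) = if a = b then c a else 0 := by
    intro a b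
    let G : Matrix (Fin n) (Fin n) ℝ := Matrix.of Γ
    let M : Matrix (Fin n) κ ℝ := Matrix.of fun i k => m k i
    have e1 : M * Matrix.diagonal w * M.transpose = G * Matrix.diagonal c * G.transpose := by
      ext i j
      have := (hK i j).symm.trans (hD i j)
      rw [Matrix.mul_apply, Matrix.mul_apply]
      simp only [Matrix.mul_diagonal, Matrix.transpose_apply]
      refine Eq.trans ?_ this
      refine Finset.sum_congr rfl fun k _ => ?_
      simp [M]; ring
    have e2 : G.transpose * G = 1 := by
      ext i j
      rw [Matrix.mul_apply, Matrix.one_apply, ← hO' i j]; rfl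
    have e3 : (G.transpose * M) * Matrix.diagonal w * (G.transpose * M).transpose
        = Matrix.diagonal c := by
      calc _ = G.transpose * (M * Matrix.diagonal w * M.transpose) * G := by
            simp [Matrix.mul_assoc]
        _ = (G.transpose * G) * Matrix.diagonal c * (G.transpose * G) := by
            rw [e1]; simp only [Matrix.mul_assoc]
        _ = _ := by rw [e2]; simp
    have := congrFun (congrFun e3 a) b
    rw [Matrix.mul_apply, Matrix.diagonal_apply] at this
    rw [← this]
    refine Finset.sum_congr rfl fun k _ => ?_
    rw [Matrix.mul_diagonal, Matrix.transpose_apply, Matrix.mul_apply, Matrix.mul_apply]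
    change w k * (u a k * u b k) = u a k * w k * u b k
    ring
  have hcl : c l = 0 := by
    by_contra hne
    have hpos : 0 < c l := lt_of_le_of_ne (hc l) (Ne.symm hne)
    have hli : LinearIndependent ℝ (fun a : {a : Fin n // a ≤ l} => u a) := by
      rw [Fintype.linearIndependent_iff]
      intro g hg a
      have h0 : ∑ k, w k * (u a k * (∑ b : {a : Fin n // a ≤ l}, g b * u b k)) = 0 := by
        refine Finset.sum_eq_zero fun k _ => ?_
        have := congrFun hg k
        simp only [Finset.sum_apply, Pi.smul_apply, smul_eq_mul, Pi.zero_apply] at this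
        rw [this]; ring
      have h1 : ∑ k, w k * (u a k * (∑ b : {a : Fin n // a ≤ l}, g b * u b k))
          = ∑ b : {a : Fin n // a ≤ l}, g b * ∑ k, w k * (u a k * u b k) := by
        simp only [Finset.mul_sum]
        rw [Finset.sum_comm]
        refine Finset.sum_congr rfl fun b _ => Finset.sum_congr rfl fun k _ => by ring
      rw [h1] at h0
      simp only [H] at h0
      rw [Finset.sum_eq_single a] at h0
      · simp only [if_true] at h0
        have : 0 < c a := hpos.trans_le (hmono _ _ a.2)
        exact (mul_eq_zero.1 h0).resolve_right this.ne'
      · intro b _ hb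
        rw [if_neg (fun h => hb (Subtype.ext h.symm)), mul_zero]
      · simp
    have := hli.fintype_card_le_finrank
    rw [Module.finrank_fintype_fun_eq_card] at this
    have hcard : Fintype.card {a : Fin n // a ≤ l} = l + 1 := by
      rw [Fintype.card_subtype]
      have : (Finset.univ.filter (fun a : Fin n => a ≤ l)) = Finset.Iic l := by ext; simp
      rw [this, Fin.card_Iic]
    omega
  have hs := H l l
  rw [if_pos rfl, hcl, Finset.sum_eq_zero_iff_of_nonneg
    (fun k _ => mul_nonneg (hw k).le (mul_self_nonneg _))] at hs
  have := hs k (Finset.mem_univ k)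
  exact mul_self_eq_zero.1 ((mul_eq_zero.1 this).resolve_left (hw k).ne')

theorem PPT.card_anti (d p : ℕ) :
    ((Finset.univ : Finset (Option (Fin d))).piAntidiag p).card = (d + p).choose d := by
  rw [← Finset.map_sym_eq_piAntidiag, Finset.card_map, Finset.sym_univ, Finset.card_univ,
    Sym.card_sym_eq_choose]
  simp only [Fintype.card_option, Fintype.card_fin]
  rw [show d + 1 + p - 1 = d + p by omega, Nat.choose_symm_add]

theorem PPT.spec_poly {n d p : ℕ} (X : Fin n → Fin d → ℝ) (F : MvPolynomial (Fin d) ℝ)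
    (hF : F.totalDegree ≤ p) (Kn Γ : Fin n → Fin n → ℝ) (c : Fin n → ℝ)
    (hKn : ∀ i j, Kn i j = (1 + ∑ k, X i k * X j k) ^ p) (hE : IsEigenDecomp Kn Γ c)
    (l : Fin n) (hl : (d + p).choose d ≤ l) : ∑ i, Γ i l * MvPolynomial.eval (X i) F = 0 := by
  classical
  let S := (Finset.univ : Finset (Option (Fin d))).piAntidiag p
  have key := PPT.spec_aux (κ := S) (fun k => (Nat.multinomial Finset.univ k.1 : ℝ))
    (fun k => by exact_mod_cast Nat.multinomial_pos _ _)
    (fun k i => ∏ t : Fin d, X i t ^ k.1 (some t)) Kn Γ c ?_ hE l ?_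
  · simp only [MvPolynomial.eval_eq, Finset.mul_sum]
    rw [Finset.sum_comm]
    refine Finset.sum_eq_zero fun e he => ?_
    have hdeg : ∑ t, e t ≤ p := by
      have := MvPolynomial.le_totalDegree he
      rw [Finsupp.sum_fintype _ _ (by simp)] at this
      exact this.trans hF
    let k : Option (Fin d) → ℕ := fun o => o.elim (p - ∑ t, e t) e
    have hk : k ∈ S := by
      simp only [S, Finset.mem_piAntidiag, Finset.mem_univ, implies_true, and_true]
      rw [Fintype.sum_option]
      simp only [k, Option.elim]
      omega
    have := key ⟨k, hk⟩
    simp only [k, Option.elim] at this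
    calc _ = MvPolynomial.coeff e F * ∑ i, Γ i l * ∏ t, X i t ^ e t := by
          rw [Finset.mul_sum]
          refine Finset.sum_congr rfl fun i _ => ?_
          rw [Finset.prod_subset (Finset.subset_univ e.support)
            (f := fun t => X i t ^ e t)]
          · ring
          · intro t _ ht
            rw [Finsupp.notMem_support_iff.1 ht, pow_zero]
      _ = 0 := by rw [this, mul_zero]
  · intro i j
    rw [hKn]
    have : (1 + ∑ k, X i k * X j k) =
        ∑ o : Option (Fin d), o.elim 1 (fun k => X i k * X j k) := by
      rw [Fintype.sum_option]; rfl
    rw [this, Finset.sum_pow_eq_sum_piAntidiag, ← Finset.sum_coe_sort]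
    refine Finset.sum_congr rfl fun k _ => ?_
    rw [Fintype.prod_option]
    simp only [Option.elim, one_pow, one_mul, mul_pow, Finset.prod_mul_distrib]
  · rw [Fintype.card_coe, PPT.card_anti]; exact hl

theorem PPT.pi_gauss_density (ι : Type*) [Fintype ι] (v : NNReal) (hv : v ≠ 0) :
    ∃ h : ℝ → ℝ≥0∞, Measurable h ∧
      Measure.pi (fun _ : ι => gaussianReal 0 v) =
        (volume : Measure (ι → ℝ)).withDensity (fun x => h (∑ i, x i ^ 2)) := by
  classical
  refine ⟨fun s => ENNReal.ofReal ((√(2 * Real.pi * v))⁻¹ ^ (Fintype.card ι) *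
    Real.exp (-s / (2 * v))), by fun_prop, ?_⟩
  have hprod : ∀ x : ι → ℝ, (√(2 * Real.pi * v))⁻¹ ^ (Fintype.card ι) *
      Real.exp (-(∑ i, x i ^ 2) / (2 * v)) = ∏ i, gaussianPDFReal 0 v (x i) := by
    intro x
    simp only [gaussianPDFReal, sub_zero]
    rw [Finset.prod_mul_distrib, Finset.prod_const, Finset.card_univ, ← Real.exp_sum,
      ← Finset.sum_div, Finset.sum_neg_distrib]
  simp only [hprod]
  refine Measure.pi_eq (fun s hs => ?_)
  have hms : MeasurableSet (Set.univ.pi s) := MeasurableSet.univ_pi hs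
  rw [withDensity_apply _ hms, ← lintegral_indicator hms]
  have h1 : ∀ x : ι → ℝ, (Set.univ.pi s).indicator
      (fun x => ENNReal.ofReal (∏ i, gaussianPDFReal 0 v (x i))) x
      = ENNReal.ofReal (∏ i, (s i).indicator (gaussianPDFReal 0 v) (x i)) := by
    intro x
    by_cases hx : x ∈ Set.univ.pi s
    · rw [Set.indicator_of_mem hx]
      congr 1
      refine Finset.prod_congr rfl fun i _ => ?_
      rw [Set.indicator_of_mem (hx i (Set.mem_univ i))]
    · rw [Set.indicator_of_notMem hx]
      simp only [Set.mem_pi, Set.mem_univ, true_imp_iff, not_forall] at hx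
      obtain ⟨i, hi⟩ := hx
      rw [Finset.prod_eq_zero (Finset.mem_univ i)]
      · simp
      · rw [Set.indicator_of_notMem hi]
  simp only [h1]
  have hint : ∀ i, Integrable ((s i).indicator (gaussianPDFReal 0 v)) :=
    fun i => (integrable_gaussianPDFReal 0 v).indicator (hs i)
  have hnn : ∀ i x, 0 ≤ (s i).indicator (gaussianPDFReal 0 v) x := fun i x =>
    Set.indicator_nonneg (fun _ _ => gaussianPDFReal_nonneg _ _ _) _
  have hI : Integrable (fun x : ι → ℝ => ∏ i, (s i).indicator (gaussianPDFReal 0 v) (x i)) :=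
    Integrable.fintype_prod hint
  rw [← ofReal_integral_eq_lintegral_ofReal hI
    (Eventually.of_forall fun x => Finset.prod_nonneg fun i _ => hnn i _)]
  rw [integral_fintype_prod_volume_eq_prod (fun i => (s i).indicator (gaussianPDFReal 0 v)),
    ENNReal.ofReal_prod_of_nonneg (fun i _ => integral_nonneg (hnn i))]
  refine Finset.prod_congr rfl fun i _ => ?_
  rw [integral_indicator (hs i), gaussianReal_apply_eq_integral _ hv]

theorem PPT.noise_rot {n : ℕ} (v : NNReal) (hv : v ≠ 0) {Γ : Fin n → Fin n → ℝ}
    (hO : IsOrthogonalF Γ) :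
    (Measure.pi (fun _ : Fin n => gaussianReal 0 v)).map (tmulVecF Γ) =
      Measure.pi (fun _ : Fin n => gaussianReal 0 v) := by
  obtain ⟨h, hh, hd⟩ := PPT.pi_gauss_density (Fin n) v hv
  have h1 : (Matrix.of Γ) * (Matrix.of Γ).transpose = 1 := by
    ext a b
    rw [Matrix.mul_apply, Matrix.one_apply, ← hO a b]; rfl
  have hfun : tmulVecF Γ = ⇑(Matrix.toLin' (Matrix.of Γ).transpose) := by
    funext x i
    simp [tmulVecF, Matrix.mulVec, dotProduct]
  have hdet : |((Matrix.of Γ).transpose.det)| = 1 := by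
    have := congrArg Matrix.det h1
    rw [Matrix.det_mul, Matrix.det_transpose, Matrix.det_one] at this
    rw [Matrix.det_transpose]
    rcases mul_self_eq_one_iff.1 this with h | h <;> rw [h] <;> simp
  have hdet0 : ((Matrix.of Γ).transpose.det) ≠ 0 := by
    intro h; rw [h] at hdet; simp at hdet
  have hmeas : Measurable (tmulVecF Γ) := by
    unfold tmulVecF; fun_prop
  have hmp : MeasurePreserving (tmulVecF Γ) volume volume := by
    refine ⟨hmeas, ?_⟩
    rw [hfun, Real.map_matrix_volume_pi_eq_smul_volume_pi hdet0, abs_inv, hdet]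
    simp
  have hnorm : ∀ x, ∑ i, tmulVecF Γ x i ^ 2 = ∑ i, x i ^ 2 := by
    intro x
    have : (Matrix.of Γ).transpose.mulVec x ⬝ᵥ (Matrix.of Γ).transpose.mulVec x = x ⬝ᵥ x := by
      rw [Matrix.dotProduct_mulVec, Matrix.vecMul_transpose, Matrix.mulVec_mulVec, h1,
        Matrix.one_mulVec]
    rw [hfun]
    simpa [dotProduct, pow_two] using this
  have hρ : Measurable (fun x : Fin n → ℝ => h (∑ i, x i ^ 2)) := by fun_prop
  rw [hd]
  ext A hA
  rw [Measure.map_apply hmeas hA, withDensity_apply _ (hmeas hA), withDensity_apply _ hA,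
    ← hmp.setLIntegral_comp_preimage hA hρ]
  simp only [hnorm]

theorem PPT.polar {E : Type*} [NormedAddCommGroup E] [NormedSpace ℝ E] [MeasurableSpace E]
    [BorelSpace E] [FiniteDimensional ℝ E] [Nontrivial E] (μ : Measure E) [μ.IsAddHaarMeasure]
    (f : E → ℝ≥0∞) (hf : Measurable f) :
    ∫⁻ x, f x ∂μ = ∫⁻ r : Set.Ioi (0 : ℝ), ∫⁻ u : Metric.sphere (0 : E) 1,
      f (r.1 • u.1) ∂μ.toSphere ∂(Measure.volumeIoiPow (Module.finrank ℝ E - 1)) := by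
  have hmp := μ.measurePreserving_homeomorphUnitSphereProd
  have hF : Measurable (fun q : Metric.sphere (0 : E) 1 × Set.Ioi (0 : ℝ) => f (q.2.1 • q.1.1)) := by
    fun_prop
  rw [← lintegral_prod_symm' _ hF, ← hmp.lintegral_comp hF]
  simp only [homeomorphUnitSphereProd_apply_fst_coe, homeomorphUnitSphereProd_apply_snd_coe]
  have h0 : ∫⁻ x, f x ∂μ = ∫⁻ x : ({0}ᶜ : Set E), f x ∂(μ.comap (↑)) := by
    rw [lintegral_subtype_comap (measurableSet_singleton _).compl, restrict_compl_singleton]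
  rw [h0]
  refine lintegral_congr fun x => ?_
  have : ‖x.1‖ ≠ 0 := norm_ne_zero_iff.2 x.2
  rw [smul_smul, mul_inv_cancel₀ this, one_smul]

theorem PPT.polar_gauss {ι : Type*} [Fintype ι] [Nonempty ι] (v : NNReal) (hv : v ≠ 0) :
    ∃ h : ℝ → ℝ≥0∞, Measurable h ∧ ∀ f : (ι → ℝ) → ℝ≥0∞, Measurable f →
      ∫⁻ x, f x ∂(Measure.pi (fun _ : ι => gaussianReal 0 v)) =
      ∫⁻ r : Set.Ioi (0 : ℝ), h r.1 * ∫⁻ u : Metric.sphere (0 : EuclideanSpace ℝ ι) 1,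
      f (fun i => r.1 * u.1 i) ∂(volume : Measure (EuclideanSpace ℝ ι)).toSphere
        ∂(Measure.volumeIoiPow (Module.finrank ℝ (EuclideanSpace ℝ ι) - 1)) := by
  obtain ⟨h, hh, hd⟩ := PPT.pi_gauss_density ι v hv
  refine ⟨fun r => h (r ^ 2), by fun_prop, fun f hf => ?_⟩
  have hρ : Measurable (fun x : ι → ℝ => h (∑ i, x i ^ 2)) := by fun_prop
  rw [hd, lintegral_withDensity_eq_lintegral_mul _ hρ hf,
    ← (PiLp.volume_preserving_ofLp ι).lintegral_comp (hρ.mul hf)]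
  rw [PPT.polar volume _ (by fun_prop)]
  refine lintegral_congr fun r => ?_
  rw [← lintegral_const_mul _ (by fun_prop)]
  refine lintegral_congr fun u => ?_
  have hu : ∑ i, (u.1 i) ^ 2 = 1 := by
    have h1 : ‖u.1‖ = 1 := by simp
    have := EuclideanSpace.norm_sq_eq u.1
    rw [h1] at this
    simpa using this.symm
  have h2 : ∑ i, (r.1 * u.1 i) ^ 2 = r.1 ^ 2 := by
    simp only [mul_pow, ← Finset.mul_sum, hu, mul_one]
  simp only [Pi.mul_apply, PiLp.smul_apply, smul_eq_mul, h2]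
  rfl

theorem PPT.radial {ι : Type*} [Fintype ι] [Nonempty ι] (v : NNReal) (hv : v ≠ 0)
    (φ : (ι → ℝ) → ℝ≥0∞) (hφ : Measurable φ) :
    ∫⁻ w, ∫⁻ g, φ (fun i => √(∑ j, w j ^ 2) * g i / √(∑ j, g j ^ 2))
      ∂(Measure.pi (fun _ : ι => gaussianReal 0 1)) ∂(Measure.pi (fun _ : ι => gaussianReal 0 v))
    = ∫⁻ w, φ w ∂(Measure.pi (fun _ : ι => gaussianReal 0 v)) := by
  obtain ⟨h1, hh1, H1⟩ := PPT.polar_gauss (ι := ι) 1 one_ne_zero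
  obtain ⟨h, hh, H⟩ := PPT.polar_gauss (ι := ι) v hv
  set τ := (volume : Measure (EuclideanSpace ℝ ι)).toSphere with hτ
  set ρ := Measure.volumeIoiPow (Module.finrank ℝ (EuclideanSpace ℝ ι) - 1) with hρ
  have hone : (∫⁻ r : Set.Ioi (0 : ℝ), h1 r.1 ∂ρ) * τ Set.univ = 1 := by
    have := H1 (fun _ => 1) measurable_const
    simp only [lintegral_const, measure_univ, one_mul] at this
    rw [lintegral_mul_const _ (by fun_prop)] at this
    exact this.symm
  have hsph : ∀ (r : ℝ), 0 < r → ∀ u : Metric.sphere (0 : EuclideanSpace ℝ ι) 1,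
      √(∑ j, (r * u.1 j) ^ 2) = r := by
    intro r hr u
    have hu : ∑ i, (u.1 i) ^ 2 = 1 := by
      have h1 : ‖u.1‖ = 1 := by simp
      have := EuclideanSpace.norm_sq_eq u.1
      rw [h1] at this
      simpa using this.symm
    simp only [mul_pow, ← Finset.mul_sum, hu, mul_one]
    exact Real.sqrt_sq hr.le
  have hinner : ∀ w : ι → ℝ, ∫⁻ g, φ (fun i => √(∑ j, w j ^ 2) * g i / √(∑ j, g j ^ 2))
      ∂(Measure.pi (fun _ : ι => gaussianReal 0 1)) =
      (∫⁻ r : Set.Ioi (0 : ℝ), h1 r.1 ∂ρ) *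
        ∫⁻ u, φ (fun i => √(∑ j, w j ^ 2) * u.1 i) ∂τ := by
    intro w
    rw [H1 _ (by fun_prop), ← lintegral_mul_const _ (by fun_prop)]
    refine lintegral_congr fun r => ?_
    congr 1
    refine lintegral_congr fun u => ?_
    congr 1
    funext i
    have hr : r.1 ≠ 0 := ne_of_gt r.2
    rw [hsph r.1 r.2 u]
    field_simp
  simp only [hinner]
  have hm : Measurable (fun w : ι → ℝ => ∫⁻ u : Metric.sphere (0 : EuclideanSpace ℝ ι) 1,
      φ (fun i => √(∑ j, w j ^ 2) * u.1 i) ∂τ) := by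
    refine Measurable.lintegral_prod_right' (f := fun q : (ι → ℝ) × Metric.sphere (0 : EuclideanSpace ℝ ι) 1 =>
      φ (fun i => √(∑ j, q.1 j ^ 2) * q.2.1 i)) ?_
    fun_prop
  rw [lintegral_const_mul _ hm, H _ hm, H _ hφ]
  rw [← lintegral_const_mul' _ _ (fun ht => ?_)]
  · refine lintegral_congr fun r => ?_
    have : ∀ u : Metric.sphere (0 : EuclideanSpace ℝ ι) 1, √(∑ j, (r.1 * u.1 j) ^ 2) = r.1 :=
      hsph r.1 r.2
    simp only [this, lintegral_const]
    calc _ = h r.1 * (∫⁻ u : Metric.sphere (0 : EuclideanSpace ℝ ι) 1,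
          φ (fun i => r.1 * u.1 i) ∂τ) * ((∫⁻ r : Set.Ioi (0 : ℝ), h1 r.1 ∂ρ) * τ Set.univ) := by
          ring
      _ = _ := by rw [hone, mul_one]
  · rw [ht] at hone
    by_cases h0 : τ Set.univ = 0
    · rw [h0] at hone; simp at hone
    · rw [ENNReal.top_mul h0] at hone; simp at hone

/-- The uniform probability measure on `M(n,b)`. -/
def PPT.permUnif (n b : ℕ) : @Measure (Equiv.Perm (Fin n)) ⊤ :=
  letI : MeasurableSpace (Equiv.Perm (Fin n)) := ⊤
  ((permSet n b).card : ℝ≥0∞)⁻¹ • ∑ ψ ∈ permSet n b, Measure.dirac ψ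

theorem PPT.permSet_card_ne (n b : ℕ) : ((permSet n b).card : ℝ≥0∞) ≠ 0 := by
  have : (1 : Equiv.Perm (Fin n)) ∈ permSet n b := by simp [permSet]
  exact_mod_cast (Finset.card_pos.2 ⟨_, this⟩).ne'

theorem PPT.permUnif_apply (n b : ℕ) (A : Set (Equiv.Perm (Fin n))) :
    (PPT.permUnif n b) A = ((permSet n b).card : ℝ≥0∞)⁻¹ *
      ∑ ψ ∈ permSet n b, A.indicator (fun _ => (1 : ℝ≥0∞)) ψ := by
  let _ : MeasurableSpace (Equiv.Perm (Fin n)) := ⊤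
  rw [PPT.permUnif, Measure.smul_apply, Measure.finsetSum_apply, smul_eq_mul]
  congr 1
  refine Finset.sum_congr rfl fun ψ _ => ?_
  rw [Measure.dirac_apply' _ (by trivial)]
  rfl

theorem PPT.disc_valid {n b : ℕ} (m : Fin n → ℝ) (v : NNReal)
    (hm : ∀ i : Fin n, n - b ≤ (i : ℕ) → m i = 0) (S : (Fin n → ℝ) → ℝ) (hS : Measurable S)
    (a : ℝ≥0∞) :
    (Measure.pi (fun i => gaussianReal (m i) v))
      {w | PPT.permUnif n b {ψ | S w ≤ S (w ∘ ψ)} ≤ a} ≤ a := by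
  classical
  let _ : MeasurableSpace (Equiv.Perm (Fin n)) := ⊤
  have : DiscreteMeasurableSpace (Equiv.Perm (Fin n)) := ⟨fun _ => trivial⟩
  set ν := PPT.permUnif n b with hν
  set μ := Measure.pi (fun i => gaussianReal (m i) v) with hμ
  have hcard := PPT.permSet_card_ne n b
  have : IsProbabilityMeasure ν := ⟨by
    rw [hν, PPT.permUnif_apply]
    simp only [Set.indicator_univ, Finset.sum_const, nsmul_eq_mul, mul_one]
    exact ENNReal.inv_mul_cancel hcard (by simp)⟩
  have hae : ∀ᵐ ψ ∂ν, ψ ∈ permSet n b := by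
    rw [ae_iff, hν, PPT.permUnif_apply, Finset.sum_eq_zero, mul_zero]
    intro ψ hψ
    exact Set.indicator_of_notMem (by simpa using hψ) _
  have hact : Measurable (fun q : (Fin n → ℝ) × Equiv.Perm (Fin n) => q.1 ∘ q.2) := by
    refine measurable_from_prod_countable_left fun ψ => ?_
    change Measurable (fun w : Fin n → ℝ => w ∘ ψ)
    exact measurable_pi_lambda _ fun i => measurable_pi_apply _
  have hinv : ∀ ψ ∈ permSet n b, μ.map (fun w => w ∘ ψ) = μ := by
    intro ψ hψ
    have hmψ : ∀ i, m (ψ i) = m i := by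
      intro i
      have hψ' : ∀ i : Fin n, (i : ℕ) < n - b → ψ i = i := by simpa [permSet] using hψ
      by_cases hi : (i : ℕ) < n - b
      · rw [hψ' i hi]
      · have : n - b ≤ ((ψ i : Fin n) : ℕ) := by
          by_contra hlt
          have h2 := ψ.injective (hψ' (ψ i) (by omega))
          rw [h2] at hlt
          omega
        rw [hm _ this, hm _ (by omega)]
    have hmeas : Measurable (fun w : Fin n → ℝ => w ∘ ψ) :=
      measurable_pi_lambda _ fun i => measurable_pi_apply _
    refine (Measure.pi_eq fun s hs => ?_).symm
    rw [Measure.map_apply hmeas (MeasurableSet.univ_pi hs)]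
    have : (fun w : Fin n → ℝ => w ∘ ψ) ⁻¹' (Set.univ.pi s) =
        Set.univ.pi (fun i => s (ψ.symm i)) := by
      ext w
      simp only [Set.mem_preimage, Set.mem_pi, Set.mem_univ, true_imp_iff, Function.comp]
      exact ⟨fun h i => by simpa using h (ψ.symm i), fun h i => by simpa using h (ψ i)⟩
    rw [this, hμ, Measure.pi_pi, ← Equiv.prod_comp ψ]
    refine Finset.prod_congr rfl fun i _ => ?_
    rw [hmψ, Equiv.symm_apply_apply]
  refine generic_valid μ ν (fun w ψ => w ∘ ψ) hact ?_ ?_ S hS a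
  · ext A hA
    rw [Measure.map_apply hact hA, Measure.prod_apply_symm (hact hA)]
    calc _ = ∫⁻ ψ, μ A ∂ν := by
          refine lintegral_congr_ae ?_
          filter_upwards [hae] with ψ hψ
          conv_rhs => rw [← hinv ψ hψ]
          have hmψ : Measurable (fun w : Fin n → ℝ => w ∘ ψ) :=
            measurable_pi_lambda _ fun i => measurable_pi_apply _
          rw [Measure.map_apply hmψ hA]
          rfl
      _ = μ A := by simp
  · intro w
    filter_upwards [hae] with ψ hψ
    ext A hA
    rw [Measure.map_apply measurable_from_top hA, Measure.map_apply measurable_from_top hA,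
      hν, PPT.permUnif_apply, PPT.permUnif_apply]
    congr 1
    have hψ' : ∀ i : Fin n, (i : ℕ) < n - b → ψ i = i := by simpa [permSet] using hψ
    refine Finset.sum_equiv (Equiv.mulLeft ψ) (fun φ => ?_) (fun φ _ => rfl)
    simp only [permSet, Finset.mem_filter, Finset.mem_univ, true_and, Equiv.coe_mulLeft,
      Equiv.Perm.mul_apply]
    constructor
    · intro h i hi
      rw [h i hi, hψ' i hi]
    · intro h i hi
      exact ψ.injective ((h i hi).trans (hψ' i hi).symm)

theorem PPT.tail_sum {n b : ℕ} (w : Fin n → ℝ) :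
    tailNormSq b w = ∑ i : {i : Fin n // ¬ ((i : ℕ) < n - b)}, w i.1 ^ 2 := by
  rw [tailNormSq]
  refine Finset.sum_subtype _ (fun i => ?_) _
  simp only [Finset.mem_filter, Finset.mem_univ, true_and, not_lt]

theorem PPT.tail_wStar {n b : ℕ} (w g : Fin n → ℝ) (hg : tailNormSq b g ≠ 0) :
    tailNormSq b (wStar b w g) = tailNormSq b w := by
  have hnn : ∀ x : Fin n → ℝ, 0 ≤ tailNormSq b x := fun x =>
    Finset.sum_nonneg fun i _ => sq_nonneg _
  have : ∀ i ∈ Finset.univ.filter (fun i : Fin n => n - b ≤ (i : ℕ)), (wStar b w g i) ^ 2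
      = tailNormSq b w / tailNormSq b g * g i ^ 2 := by
    intro i hi
    have : ¬ ((i : ℕ) < n - b) := by simpa using hi
    rw [wStar, if_neg this, div_pow, mul_pow, Real.sq_sqrt (hnn _), Real.sq_sqrt (hnn _)]
    ring
  conv_lhs => rw [tailNormSq]
  rw [Finset.sum_congr rfl this, ← Finset.mul_sum]
  change tailNormSq b w / tailNormSq b g * tailNormSq b g = _
  field_simp

theorem PPT.split_key {Ω A B : Type*} [MeasurableSpace Ω] [MeasurableSpace A] [MeasurableSpace B]
    (μ ν : Measure Ω) (μh νh : Measure A) (μt νt : Measure B)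
    [IsProbabilityMeasure μ] [IsProbabilityMeasure ν] [IsProbabilityMeasure μh]
    [IsProbabilityMeasure νh] [IsProbabilityMeasure μt] [IsProbabilityMeasure νt]
    (e : A × B → Ω) (he : Measurable e)
    (E1 : MeasurePreserving e (μh.prod μt) μ) (E2 : MeasurePreserving e (νh.prod νt) ν)
    (act : Ω → Ω → Ω) (hact : Measurable (fun q : Ω × Ω => act q.1 q.2))
    (R : B → B → B) (hstar : ∀ q q', act (e q) (e q') = e (q.1, R q.2 q'.2))
    (hR : ∀ φ : B → ℝ≥0∞, Measurable φ → ∫⁻ w, ∫⁻ g, φ (R w g) ∂νt ∂μt = ∫⁻ w, φ w ∂μt) :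
    (μ.prod ν).map (fun q : Ω × Ω => act q.1 q.2) = μ := by
  have key : ∀ φ : Ω → ℝ≥0∞, Measurable φ →
      ∫⁻ w, ∫⁻ g, φ (act w g) ∂ν ∂μ = ∫⁻ w, φ w ∂μ := by
    intro φ hφ
    have i1 : ∀ q : A × B, ∫⁻ g, φ (act (e q) g) ∂ν = ∫⁻ g, φ (e (q.1, R q.2 g)) ∂νt := by
      intro q
      have hmm : Measurable fun g => φ (act (e q) g) :=
        hφ.comp (hact.comp measurable_prodMk_left)
      rw [← E2.lintegral_comp hmm, lintegral_prod _ (by exact (hmm.comp he).aemeasurable)]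
      simp only [hstar, lintegral_const, measure_univ, mul_one]
    have hmL : Measurable fun w => ∫⁻ g, φ (act w g) ∂ν :=
      Measurable.lintegral_prod_right' (f := fun q : Ω × Ω => φ (act q.1 q.2)) (hφ.comp hact)
    rw [← E1.lintegral_comp hmL, ← E1.lintegral_comp hφ,
      lintegral_prod _ (by exact (hmL.comp he).aemeasurable),
      lintegral_prod _ (by exact (hφ.comp he).aemeasurable)]
    refine lintegral_congr fun x => ?_
    simp only [i1]
    exact hR (fun y => φ (e (x, y))) (hφ.comp (he.comp measurable_prodMk_left))
  ext A hA
  rw [Measure.map_apply hact hA, Measure.prod_apply (hact hA)]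
  have := key (A.indicator 1) (measurable_one.indicator hA)
  rw [lintegral_indicator_one hA] at this
  rw [← this]
  refine lintegral_congr fun w => ?_
  rw [← lintegral_indicator_one (measurable_prodMk_left (hact hA))]
  rfl

theorem PPT.cont_valid {n b : ℕ} (hb1 : 1 ≤ b) (hbn : b ≤ n) (m : Fin n → ℝ)
    (v : NNReal) (hv : v ≠ 0)
    (hm : ∀ i : Fin n, n - b ≤ (i : ℕ) → m i = 0) (S : (Fin n → ℝ) → ℝ) (hS : Measurable S)
    (a : ℝ≥0∞) :
    (Measure.pi (fun i => gaussianReal (m i) v))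
      {w | stdGaussianPi n {g | S w ≤ S (wStar b w g)} ≤ a} ≤ a := by
  classical
  set μ := Measure.pi (fun i => gaussianReal (m i) v) with hμ
  have : IsProbabilityMeasure (stdGaussianPi n) := by unfold stdGaussianPi; infer_instance
  have hact : Measurable (fun q : (Fin n → ℝ) × (Fin n → ℝ) => wStar b q.1 q.2) := by
    refine measurable_pi_lambda _ fun i => ?_
    unfold wStar tailNormSq
    by_cases hi : (i : ℕ) < n - b
    · simp only [hi, if_true]; fun_prop
    · simp only [hi, if_false]; fun_prop
  have hi0 : n - b < n := by omega
  have htail : ∀ᵐ g ∂(stdGaussianPi n), tailNormSq b g ≠ 0 := by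
    have h1 : ∀ᵐ g ∂(stdGaussianPi n), g ⟨n - b, hi0⟩ ≠ 0 := by
      have hmp := measurePreserving_eval (fun _ : Fin n => gaussianReal 0 1) ⟨n - b, hi0⟩
      have := nullSingletonClass_gaussianReal (μ := 0) (v := 1) one_ne_zero
      have : ∀ᵐ x ∂(gaussianReal 0 1), x ≠ 0 := by
        rw [ae_iff]
        simp only [ne_eq, not_not, Set.setOf_eq_eq_singleton]
        exact measure_singleton _
      exact hmp.quasiMeasurePreserving.ae this
    filter_upwards [h1] with g hg h0
    rw [tailNormSq, Finset.sum_eq_zero_iff_of_nonneg (fun i _ => sq_nonneg _)] at h0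
    have := h0 ⟨n - b, hi0⟩ (by simp only [Finset.mem_filter, Finset.mem_univ, true_and, le_refl])
    exact hg (by simpa using this)
  refine generic_valid μ (stdGaussianPi n) (fun w g => wStar b w g) hact ?_ ?_ S hS a
  · -- invariance
    let P : Fin n → Prop := fun i => (i : ℕ) < n - b
    have : Nonempty {i // ¬ P i} := ⟨⟨⟨n - b, hi0⟩, by simp [P]⟩⟩
    let e := MeasurableEquiv.piEquivPiSubtypeProd (fun _ : Fin n => ℝ) P
    have E1 := (measurePreserving_piEquivPiSubtypeProd (fun i => gaussianReal (m i) v) P).symm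
    have E2 := (measurePreserving_piEquivPiSubtypeProd (fun _ : Fin n => gaussianReal 0 1) P).symm
    have ht : (fun i : {i // ¬ P i} => gaussianReal (m i) v) = fun _ => gaussianReal 0 v := by
      funext i
      rw [hm _ (by simpa [P] using i.2)]
    rw [ht] at E1
    have hstar : ∀ q q' : ({i // P i} → ℝ) × ({i // ¬ P i} → ℝ),
        wStar b (e.symm q) (e.symm q') =
        e.symm (q.1, fun i => √(∑ j, q.2 j ^ 2) * q'.2 i / √(∑ j, q'.2 j ^ 2)) := by
      intro q q'
      have hsym : ∀ (r : ({i // P i} → ℝ) × ({i // ¬ P i} → ℝ)) (i : Fin n),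
        e.symm r i = if h : P i then r.1 ⟨i, h⟩ else r.2 ⟨i, h⟩ := fun r i => rfl
      have htl : ∀ r : ({i // P i} → ℝ) × ({i // ¬ P i} → ℝ),
          tailNormSq b (e.symm r) = ∑ j, r.2 j ^ 2 := by
        intro r
        rw [PPT.tail_sum]
        refine Finset.sum_congr rfl fun i _ => ?_
        rw [hsym, dif_neg i.2]
      funext i
      rw [wStar, htl, htl, hsym, hsym, hsym]
      by_cases hi : P i
      · rw [if_pos hi, dif_pos hi, dif_pos hi]
      · rw [if_neg hi, dif_neg hi, dif_neg hi]
    exact PPT.split_key _ _ _ _ _ _ e.symm e.symm.measurable E1 E2 _ hact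
      (fun w g i => √(∑ j, w j ^ 2) * g i / √(∑ j, g j ^ 2)) hstar
      (fun φ hφ => PPT.radial v hv φ hφ)
  · intro w
    filter_upwards [htail] with g hg
    congr 1
    funext g' i
    rw [wStar, PPT.tail_wStar w g hg]
    by_cases hi : (i : ℕ) < n - b
    · rw [if_pos hi, wStar, wStar, if_pos hi, if_pos hi]
    · rw [if_neg hi, wStar, if_neg hi]


open PPT in
/-- Theorem 2: validity of the discrete and continuous partial permutation
tests with the degree-`p` polynomial kernel, when the true regression function is a polynomial
of total degree at most `p` and the noises are i.i.d. centered Gaussian. -/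
theorem partial_permutation_valid_polynomial
    {n d H : ℕ} (hn : 1 ≤ n) (hd : 1 ≤ d) (p : ℕ) (hp : 1 ≤ p)
    (X : Fin n → Fin d → ℝ) (Z : Fin n → Fin H)
    -- the true functional relationship is polynomial of total degree at most p
    (f0 : (Fin d → ℝ) → ℝ) (F : MvPolynomial (Fin d) ℝ)
    (hFdeg : F.totalDegree ≤ p)
    (hf0 : ∀ x, f0 x = MvPolynomial.eval x F)
    -- noise level
    (σ0 : ℝ) (hσ0 : 0 < σ0)
    -- the law of Y = f0(X) + ε with ε ~ N(0, σ0² Iₙ)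
    (μY : Measure (Fin n → ℝ))
    (hμY : μY = Measure.map (fun ε : Fin n → ℝ => fun i => f0 (X i) + ε i) (noiseLaw n σ0))
    -- sample kernel matrix of the polynomial kernel K(x,x') = (1 + xᵀx')^p
    (Kn : Fin n → Fin n → ℝ)
    (hKn : ∀ i j, Kn i j = (1 + ∑ k, X i k * X j k) ^ p)
    -- a fixed eigendecomposition Kn = Γ diag(c) Γᵀ
    (Γ : Fin n → Fin n → ℝ) (c : Fin n → ℝ) (hEig : IsEigenDecomp Kn Γ c)
    -- permutation size
    (b : ℕ) (hb1 : 1 ≤ b) (hb2 : b ≤ n - Nat.choose (d + p) d)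
    -- arbitrary (measurable) test statistic
    (T : (Fin n → Fin d → ℝ) → (Fin n → ℝ) → (Fin n → Fin H) → ℝ)
    (hT : Measurable fun y => T X y Z) :
    ∀ α ∈ Set.Ioo (0 : ℝ) 1,
      μY {y | pDisc X Z T Γ b y ≤ α} ≤ ENNReal.ofReal α ∧
      μY {y | pCont X Z T Γ b y ≤ α} ≤ ENNReal.ofReal α := by
  intro α hα
  have hbn : b ≤ n := hb2.trans (Nat.sub_le _ _)
  have hnb : Nat.choose (d + p) d ≤ n - b := by omega
  set v : NNReal := (σ0 ^ 2).toNNReal with hv_def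
  have hv : v ≠ 0 := by
    have : 0 < v := Real.toNNReal_pos.2 (by positivity)
    exact this.ne'
  let m : Fin n → ℝ := tmulVecF Γ (fun i => f0 (X i))
  have hm : ∀ i : Fin n, n - b ≤ (i : ℕ) → m i = 0 := by
    intro i hi
    have := PPT.spec_poly X F hFdeg Kn Γ c hKn hEig i (hnb.trans hi)
    simpa only [m, tmulVecF, hf0] using this
  have hΓm : Measurable (tmulVecF Γ) := by unfold tmulVecF; fun_prop
  have hΓm' : Measurable (mulVecF Γ) := by unfold mulVecF; fun_prop
  have hinvΓ : ∀ y, mulVecF Γ (tmulVecF Γ y) = y := by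
    intro y
    funext i
    simp only [mulVecF, tmulVecF, Finset.mul_sum]
    rw [Finset.sum_comm]
    have : ∀ j, ∑ k, Γ i k * (Γ j k * y j) = (if i = j then 1 else 0) * y j := by
      intro j
      rw [← hEig.1 i j, Finset.sum_mul]
      exact Finset.sum_congr rfl fun k _ => by ring
    simp [this]
  have hlaw : μY.map (tmulVecF Γ) = Measure.pi (fun i => gaussianReal (m i) v) := by
    have hadd : Measurable (fun ε : Fin n → ℝ => fun i => f0 (X i) + ε i) := by fun_prop
    have hadd' : Measurable (fun ε : Fin n → ℝ => fun i => m i + ε i) := by fun_prop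
    rw [hμY, Measure.map_map hΓm hadd]
    have hcomp : tmulVecF Γ ∘ (fun ε : Fin n → ℝ => fun i => f0 (X i) + ε i)
        = (fun ε : Fin n → ℝ => fun i => m i + ε i) ∘ tmulVecF Γ := by
      funext ε i
      simp only [Function.comp, tmulVecF, m, mul_add, Finset.sum_add_distrib]
    rw [hcomp, ← Measure.map_map hadd' hΓm, noiseLaw, PPT.noise_rot v hv hEig.1]
    rw [Measure.pi_map_pi (f := fun i x => m i + x) (fun i => by fun_prop)]
    congr 1
    funext i
    rw [gaussianReal_map_const_add, zero_add]
  let S : (Fin n → ℝ) → ℝ := fun w => T X (mulVecF Γ w) Z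
  have hS : Measurable S := hT.comp hΓm'
  have hSy : ∀ y, S (tmulVecF Γ y) = T X y Z := fun y => by simp only [S, hinvΓ]
  have hα0 : 0 ≤ α := hα.1.le
  constructor
  · have h := PPT.disc_valid m v hm S hS (ENNReal.ofReal α)
    rw [← hlaw] at h
    refine le_trans ?_ h
    refine le_trans (measure_mono fun y hy => ?_)
      (Measure.le_map_apply hΓm.aemeasurable _)
    change PPT.permUnif n b {ψ | S (tmulVecF Γ y) ≤ S (tmulVecF Γ y ∘ ψ)} ≤ ENNReal.ofReal α
    have hy' : pDisc X Z T Γ b y ≤ α := hy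
    refine le_trans (le_of_eq ?_) (ENNReal.ofReal_le_ofReal hy')
    have hc0 : (0 : ℝ) < (permSet n b).card := by
      have := PPT.permSet_card_ne n b
      have h2 : (permSet n b).card ≠ 0 := by exact_mod_cast this
      exact_mod_cast Nat.pos_of_ne_zero h2
    rw [PPT.permUnif_apply, pDisc, ENNReal.ofReal_mul (inv_nonneg.2 hc0.le),
      ENNReal.ofReal_inv_of_pos hc0, ENNReal.ofReal_natCast,
      ENNReal.ofReal_sum_of_nonneg (fun i _ => by split_ifs <;> norm_num)]
    congr 1
    refine Finset.sum_congr rfl fun ψ _ => ?_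
    rw [Set.indicator_apply]
    simp only [Set.mem_setOf_eq, hSy]
    change (if T X y Z ≤ T X (mulVecF Γ (tmulVecF Γ y ∘ ψ)) Z then (1 : ℝ≥0∞) else 0) = _
    split_ifs <;> simp
  · have h := PPT.cont_valid hb1 hbn m v hv hm S hS (ENNReal.ofReal α)
    rw [← hlaw] at h
    refine le_trans ?_ h
    refine le_trans (measure_mono fun y hy => ?_)
      (Measure.le_map_apply hΓm.aemeasurable _)
    change stdGaussianPi n {g | S (tmulVecF Γ y) ≤ S (wStar b (tmulVecF Γ y) g)}
      ≤ ENNReal.ofReal α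
    have hy' : pCont X Z T Γ b y ≤ α := hy
    have : IsProbabilityMeasure (stdGaussianPi n) := by unfold stdGaussianPi; infer_instance
    rw [ENNReal.le_ofReal_iff_toReal_le (measure_ne_top _ _) hα0, hSy]
    exact hy'
end
end

section
/- Fix n ≥ 1, d ≥ 1, a covariate matrix X ∈ ℝ^{n×d}, and group labels Z ∈ {1,…,H}ⁿ. Let the kernel have a finite-dimensional feature representation K(x,x') = φ(x)ᵀφ(x') for a map φ : ℝᵈ → ℝ^q with q < ∞, and suppose Y = f₀(X) + ε where f₀(x) = βᵀφ(x) for some β ∈ ℝ^q, f₀(X) = (f₀(X_1),…,f₀(X_n))ᵀ, and ε ~ N(0, σ₀² I_n) with σ₀ > 0. Then for kernel K, any permutation size b with 1 ≤ b ≤ n − q, and any test statistic T, both the discrete and the continuous partial permutation p-values are valid: Pr(p(X,Y,Z) ≤ α) ≤ α for every α ∈ (0,1). -/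
open MeasureTheory ProbabilityTheory Filter

noncomputable section

namespace PPT

lemma upper_tail_le (ρ : Measure ℝ) [IsProbabilityMeasure ρ] (a : ENNReal) :
    ρ {x | ρ (Set.Ici x) ≤ a} ≤ a := by
  have hU : IsUpperSet {x | ρ (Set.Ici x) ≤ a} := fun x y hxy hx =>
    (measure_mono (Set.Ici_subset_Ici.2 hxy)).trans hx
  rw [hU.ordConnected.measurableSet.measure_eq_iSup_isCompact]
  refine iSup₂_le fun K hK => iSup_le fun hKc => ?_
  rcases K.eq_empty_or_nonempty with rfl | hne
  · simp
  · obtain ⟨m, hm, hmin⟩ := hKc.exists_isLeast hne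
    exact (measure_mono fun x hx => hmin hx).trans (hK hm)

lemma valid_general {Ω G : Type*} [MeasurableSpace Ω] [MeasurableSpace G]
    (ν : Measure Ω) [IsProbabilityMeasure ν] (γ : Measure G) [IsProbabilityMeasure γ]
    (A : G → Ω → Ω) (hA : Measurable fun p : Ω × G => A p.2 p.1)
    (hinv : ∀ F : Ω → ENNReal, Measurable F → ∫⁻ w, ∫⁻ g, F (A g w) ∂γ ∂ν = ∫⁻ w, F w ∂ν)
    (hcomp : ∀ᵐ g ∂γ, ∀ w, ∀ B : Set Ω, MeasurableSet B →
      γ {g' | A g' (A g w) ∈ B} = γ {g' | A g' w ∈ B})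
    (S : Ω → ℝ) (hS : Measurable S) (α : ℝ) (hα : 0 ≤ α) :
    MeasurableSet {w | (γ {g | S w ≤ S (A g w)}).toReal ≤ α} ∧
    ν {w | (γ {g | S w ≤ S (A g w)}).toReal ≤ α} ≤ ENNReal.ofReal α := by
  have hm : Measurable fun w => γ {g | S w ≤ S (A g w)} := by
    have : MeasurableSet {p : Ω × G | S p.1 ≤ S (A p.2 p.1)} :=
      measurableSet_le (hS.comp measurable_fst) (hS.comp hA)
    exact measurable_measure_prodMk_left this
  have hD : MeasurableSet {w | (γ {g | S w ≤ S (A g w)}).toReal ≤ α} :=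
    measurableSet_le hm.ennreal_toReal measurable_const
  refine ⟨hD, ?_⟩
  set D := {w | (γ {g | S w ≤ S (A g w)}).toReal ≤ α} with hDdef
  have hAw : ∀ w, Measurable fun g => A g w := fun w => hA.comp measurable_prodMk_left
  have key : ∀ w, γ {g | A g w ∈ D} ≤ ENNReal.ofReal α := by
    intro w
    have hSm : Measurable fun g => S (A g w) := hS.comp (hAw w)
    have : IsProbabilityMeasure (γ.map fun g => S (A g w)) :=
      Measure.isProbabilityMeasure_map hSm.aemeasurable
    have h1 := upper_tail_le (γ.map fun g => S (A g w)) (ENNReal.ofReal α)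
    have hU : IsUpperSet {x | (γ.map fun g => S (A g w)) (Set.Ici x) ≤ ENNReal.ofReal α} :=
      fun x y hxy hx => (measure_mono (Set.Ici_subset_Ici.2 hxy)).trans hx
    rw [Measure.map_apply hSm hU.ordConnected.measurableSet] at h1
    refine le_trans (measure_mono_ae ?_) h1
    filter_upwards [hcomp] with g hg hgD
    have hgD' : (γ {g' | S (A g w) ≤ S (A g' (A g w))}).toReal ≤ α := hgD
    have h2 := hg w {w' | S (A g w) ≤ S w'} (measurableSet_le measurable_const hS)
    simp only [Set.mem_ofPred_eq] at h2
    rw [h2] at hgD'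
    change (γ.map fun g => S (A g w)) (Set.Ici (S (A g w))) ≤ ENNReal.ofReal α
    rw [Measure.map_apply hSm measurableSet_Ici]
    exact (ENNReal.le_ofReal_iff_toReal_le (measure_ne_top _ _) hα).2 hgD'
  calc ν D = ∫⁻ w, D.indicator 1 w ∂ν := (lintegral_indicator_one hD).symm
    _ = ∫⁻ w, ∫⁻ g, D.indicator 1 (A g w) ∂γ ∂ν := (hinv _ (measurable_one.indicator hD)).symm
    _ ≤ ∫⁻ w, ENNReal.ofReal α ∂ν := by
        refine lintegral_mono fun w => ?_
        have : (fun g => D.indicator (1 : Ω → ENNReal) (A g w))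
            = {g | A g w ∈ D}.indicator (1 : G → ENNReal) := by
          ext g; simp [Set.indicator]
        have hm2 : MeasurableSet {g | A g w ∈ D} := hAw w hD
        change lintegral γ (fun g => D.indicator (1 : Ω → ENNReal) (A g w)) ≤ _
        rw [this, lintegral_indicator_one hm2]
        exact key w
    _ = ENNReal.ofReal α := by simp

/-! Polar coordinates -/

lemma lintegral_polar {E : Type*} [NormedAddCommGroup E] [NormedSpace ℝ E] [MeasurableSpace E]
    [BorelSpace E] [FiniteDimensional ℝ E] [Nontrivial E] (μ : Measure E) [μ.IsAddHaarMeasure]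
    (F : E → ENNReal) (hF : Measurable F) :
    ∫⁻ x, F x ∂μ = ∫⁻ u : Metric.sphere (0 : E) 1, ∫⁻ r : Set.Ioi (0 : ℝ), F (r.1 • u.1)
      ∂(Measure.volumeIoiPow (Module.finrank ℝ E - 1)) ∂μ.toSphere := by
  have h0 : ∫⁻ x, F x ∂μ = ∫⁻ x in ({0}ᶜ : Set E), F x ∂μ := by
    rw [setLIntegral_congr (t := Set.univ), setLIntegral_univ]
    exact ae_eq_univ.2 (by simp)
  rw [h0, ← lintegral_subtype_comap (measurableSet_singleton _).compl,
    ← lintegral_prod (fun p : Metric.sphere (0 : E) 1 × Set.Ioi (0 : ℝ) => F (p.2.1 • p.1.1))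
      (by fun_prop),
    ← (μ.measurePreserving_homeomorphUnitSphereProd).lintegral_comp (by fun_prop)]
  refine lintegral_congr fun x => ?_
  congr 1
  have hx : ‖(x : E)‖ ≠ 0 := norm_ne_zero_iff.2 x.2
  simp [smul_smul, hx]

lemma radial_resample {E : Type*} [NormedAddCommGroup E] [NormedSpace ℝ E] [MeasurableSpace E]
    [BorelSpace E] [FiniteDimensional ℝ E] [Nontrivial E] (μ : Measure E) [μ.IsAddHaarMeasure]
    (h1 h2 : ℝ → ENNReal) (hh1 : Measurable h1) (hh2 : Measurable h2)
    (hp : IsProbabilityMeasure (μ.withDensity fun x => h2 ‖x‖))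
    (F : E → ENNReal) (hF : Measurable F) :
    ∫⁻ x, ∫⁻ y, F ((‖x‖ / ‖y‖) • y) ∂(μ.withDensity fun x => h2 ‖x‖)
      ∂(μ.withDensity fun x => h1 ‖x‖) = ∫⁻ x, F x ∂(μ.withDensity fun x => h1 ‖x‖) := by
  set κ := Measure.volumeIoiPow (Module.finrank ℝ E - 1)
  set s := μ.toSphere
  have hnorm : ∀ (u : Metric.sphere (0 : E) 1) (r : Set.Ioi (0 : ℝ)), ‖r.1 • u.1‖ = r.1 := by
    intro u r
    have : 0 < r.1 := r.2
    simp [norm_smul, abs_of_pos this]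
  have hpol : ∀ (h : ℝ → ENNReal) (hh : Measurable h) (G : E → ENNReal) (hG : Measurable G),
      ∫⁻ x, G x ∂(μ.withDensity fun x => h ‖x‖)
        = ∫⁻ u, ∫⁻ r, h r.1 * G (r.1 • u.1) ∂κ ∂s := by
    intro h hh G hG
    rw [lintegral_withDensity_eq_lintegral_mul _ (by fun_prop) hG, lintegral_polar μ _ (by fun_prop)]
    simp only [Pi.mul_apply, hnorm]
    rfl
  set c2 := ∫⁻ r : Set.Ioi (0 : ℝ), h2 r.1 ∂κ with hc2
  have hc : c2 * s Set.univ = 1 := by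
    have := hpol h2 hh2 (fun _ => 1) measurable_const
    simp only [lintegral_one, measure_univ, mul_one, lintegral_const] at this
    exact this.symm
  have hin : ∀ x : E, ∫⁻ y : E, F ((‖x‖ / ‖y‖) • y) ∂(μ.withDensity fun x => h2 ‖x‖)
      = c2 * ∫⁻ u, F (‖x‖ • u.1) ∂s := by
    intro x
    rw [hpol h2 hh2 (fun y => F ((‖x‖ / ‖y‖) • y)) (by fun_prop)]
    simp only [hnorm]
    rw [← lintegral_const_mul _ (by fun_prop)]
    refine lintegral_congr fun u => ?_
    rw [hc2, ← lintegral_mul_const _ (by fun_prop)]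
    refine lintegral_congr fun r => ?_
    have : r.1 ≠ 0 := ne_of_gt r.2
    rw [smul_smul, div_mul_cancel₀ _ this]
  simp only [hin]
  have hmeas : Measurable fun x : E => ∫⁻ u : Metric.sphere (0 : E) 1, F (‖x‖ • u.1) ∂s := by
    have : Measurable fun p : E × Metric.sphere (0 : E) 1 => F (‖p.1‖ • p.2.1) := by fun_prop
    exact this.lintegral_prod_right'
  rw [lintegral_const_mul _ hmeas, hpol h1 hh1 _ hmeas, hpol h1 hh1 _ hF]
  simp only [hnorm]
  rw [lintegral_const, mul_comm, mul_assoc, mul_comm (s Set.univ), hc, mul_one]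
  rw [lintegral_lintegral_swap (by fun_prop)]
  refine lintegral_congr fun r => ?_
  rw [lintegral_const_mul _ (by fun_prop)]

/-! Gaussian density -/

lemma lintegral_pi_prod {ι : Type*} [Fintype ι] (m : ι → Measure ℝ) [∀ i, IsProbabilityMeasure (m i)]
    (h : ι → ℝ → ENNReal) (hh : ∀ i, Measurable (h i)) :
    ∫⁻ x, ∏ i, h i (x i) ∂(Measure.pi m) = ∏ i, ∫⁻ t, h i t ∂(m i) := by
  have hi : iIndepFun (fun i (x : ι → ℝ) => h i (x i)) (Measure.pi m) :=
    iIndepFun_pi fun i => (hh i).aemeasurable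
  rw [lintegral_prod_eq_prod_lintegral_of_indepFun Finset.univ _ hi
    (fun i => (hh i).comp (measurable_pi_apply i))]
  refine Finset.prod_congr rfl fun i _ => ?_
  exact (measurePreserving_eval m i).lintegral_comp (hh i)

lemma pi_gaussian_density {ι : Type*} [Fintype ι] (v : NNReal) (hv : v ≠ 0) :
    (Measure.pi fun _ : ι => gaussianReal 0 v)
      = (volume : Measure (ι → ℝ)).withDensity fun x => ∏ i, gaussianPDF 0 v (x i) := by
  have hpm : Measurable fun x : ι → ℝ => ∏ i, gaussianPDF 0 v (x i) :=
    Finset.measurable_prod _ fun i _ => (measurable_gaussianPDF 0 v).comp (measurable_pi_apply i)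
  have hne0 : ∀ t, gaussianPDF 0 v t ≠ 0 := fun t => (gaussianPDF_pos 0 hv t).ne'
  have hnet : ∀ t, gaussianPDF 0 v t ≠ ⊤ := fun t => by simp [gaussianPDF]
  have hvol : (volume : Measure (ι → ℝ)) = (Measure.pi fun _ : ι => gaussianReal 0 v).withDensity
      fun x => ∏ i, (gaussianPDF 0 v (x i))⁻¹ := by
    rw [volume_pi]
    refine Measure.pi_eq fun B hB => ?_
    rw [withDensity_apply _ (MeasurableSet.univ_pi hB), ← lintegral_indicator (MeasurableSet.univ_pi hB)]
    have : (fun x : ι → ℝ => (Set.univ.pi B).indicator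
        (fun x => ∏ i, (gaussianPDF 0 v (x i))⁻¹) x)
        = fun x => ∏ i, (B i).indicator (gaussianPDF 0 v)⁻¹ (x i) := by
      ext x
      by_cases hx : x ∈ Set.univ.pi B
      · rw [Set.indicator_of_mem hx]
        exact Finset.prod_congr rfl fun i _ =>
          (Set.indicator_of_mem (hx i trivial) (gaussianPDF 0 v)⁻¹).symm
      · rw [Set.indicator_of_notMem hx]
        simp only [Set.mem_pi, Set.mem_univ, true_implies, not_forall] at hx
        obtain ⟨i, hi⟩ := hx
        exact (Finset.prod_eq_zero (Finset.mem_univ i) (Set.indicator_of_notMem hi _)).symm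
    rw [this, lintegral_pi_prod _ _
      (fun i => (measurable_gaussianPDF 0 v).inv.indicator (hB i))]
    refine Finset.prod_congr rfl fun i _ => ?_
    rw [lintegral_indicator (hB i), gaussianReal_of_var_ne_zero _ hv,
      setLIntegral_withDensity_eq_setLIntegral_mul _ (measurable_gaussianPDF 0 v)
        (measurable_gaussianPDF 0 v).inv (hB i)]
    simp [ENNReal.mul_inv_cancel (hne0 _) (hnet _)]
  conv_rhs => rw [hvol]
  have hinvm : Measurable fun x : ι → ℝ => ∏ i, (gaussianPDF 0 v (x i))⁻¹ :=
    Finset.measurable_prod _ fun i _ =>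
      (measurable_gaussianPDF 0 v).inv.comp (measurable_pi_apply i)
  rw [← withDensity_mul _ hinvm hpm]
  have : ((fun x : ι → ℝ => ∏ i, (gaussianPDF 0 v (x i))⁻¹) * fun x => ∏ i, gaussianPDF 0 v (x i))
      = 1 := by
    ext x
    simp only [Pi.mul_apply, Pi.one_apply, ← Finset.prod_mul_distrib]
    exact Finset.prod_eq_one fun i _ => ENNReal.inv_mul_cancel (hne0 _) (hnet _)
  rw [this, withDensity_one]

/-- radial profile of the Gaussian density -/
def gprof (k : ℕ) (v : NNReal) (r : ℝ) : ENNReal :=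
  ENNReal.ofReal ((Real.sqrt (2 * Real.pi * v))⁻¹ ^ k * Real.exp (-r ^ 2 / (2 * v)))

lemma measurable_gprof (k : ℕ) (v : NNReal) : Measurable (gprof k v) := by
  unfold gprof; fun_prop

lemma toLp_gaussian_density {ι : Type*} [Fintype ι] (v : NNReal) (hv : v ≠ 0) :
    (Measure.pi fun _ : ι => gaussianReal 0 v).map (WithLp.toLp 2)
      = (volume : Measure (EuclideanSpace ℝ ι)).withDensity
        fun x => gprof (Fintype.card ι) v ‖x‖ := by
  have hprod : ∀ x : EuclideanSpace ℝ ι, gprof (Fintype.card ι) v ‖x‖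
      = ∏ i, gaussianPDF 0 v (x i) := by
    intro x
    simp only [gprof, gaussianPDF, gaussianPDFReal]
    rw [← ENNReal.ofReal_prod_of_nonneg (fun i _ => by positivity), Finset.prod_mul_distrib,
      ← Real.exp_sum, Finset.prod_const, EuclideanSpace.real_norm_sq_eq]
    simp [Finset.sum_div, neg_div]
  have hpm : Measurable fun x : ι → ℝ => ∏ i, gaussianPDF 0 v (x i) :=
    Finset.measurable_prod _ fun i _ => (measurable_gaussianPDF 0 v).comp (measurable_pi_apply i)
  have hmp := PiLp.volume_preserving_toLp ι
  ext s hs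
  rw [Measure.map_apply hmp.measurable hs, withDensity_apply _ hs, pi_gaussian_density v hv,
    withDensity_apply _ (hmp.measurable hs)]
  simp only [hprod]
  rw [← hmp.setLIntegral_comp_preimage hs]
  exact hpm.comp (PiLp.volume_preserving_ofLp ι).measurable

lemma gaussian_isometry {ι : Type*} [Fintype ι] (v : NNReal) (hv : v ≠ 0)
    (L : EuclideanSpace ℝ ι ≃ₗᵢ[ℝ] EuclideanSpace ℝ ι) :
    ((Measure.pi fun _ : ι => gaussianReal 0 v).map (WithLp.toLp 2)).map L
      = (Measure.pi fun _ : ι => gaussianReal 0 v).map (WithLp.toLp 2) := by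
  rw [toLp_gaussian_density v hv]
  ext s hs
  have hmp := L.measurePreserving
  rw [Measure.map_apply hmp.measurable hs, withDensity_apply _ hs,
    withDensity_apply _ (hmp.measurable hs), ← hmp.setLIntegral_comp_preimage hs]
  · simp
  · exact (measurable_gprof _ v).comp measurable_norm
lemma measurable_wStar {n : ℕ} (b : ℕ) :
    Measurable fun p : (Fin n → ℝ) × (Fin n → ℝ) => wStar b p.1 p.2 := by
  refine measurable_pi_lambda _ fun i => ?_
  unfold wStar tailNormSq
  by_cases h : (i : ℕ) < n - b
  · simp only [h, if_true]; fun_prop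
  · simp only [h, if_false]; fun_prop

lemma tailNormSq_eq {n : ℕ} (b : ℕ) (w : Fin n → ℝ) :
    tailNormSq b w = ∑ i : {i : Fin n // ¬ (i : ℕ) < n - b}, w i ^ 2 := by
  unfold tailNormSq
  refine Finset.sum_subtype _ (fun i => ?_) (fun i => w i ^ 2)
  simp

lemma wStar_wStar {n : ℕ} (b : ℕ) (w g g' : Fin n → ℝ) (hg : tailNormSq b g ≠ 0) :
    wStar b (wStar b w g) g' = wStar b w g' := by
  have hw0 : 0 ≤ tailNormSq b w := Finset.sum_nonneg fun _ _ => sq_nonneg _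
  have hg0 : 0 ≤ tailNormSq b g := Finset.sum_nonneg fun _ _ => sq_nonneg _
  have ht : tailNormSq b (wStar b w g) = tailNormSq b w := by
    have : tailNormSq b (wStar b w g) = ∑ i ∈ Finset.univ.filter (fun i : Fin n => n - b ≤ (i : ℕ)),
        tailNormSq b w / tailNormSq b g * g i ^ 2 := by
      rw [tailNormSq]
      refine Finset.sum_congr rfl fun i hi => ?_
      have : ¬ (i : ℕ) < n - b := not_lt.2 (Finset.mem_filter.1 hi).2
      simp only [wStar, this, if_false]
      rw [div_pow, mul_pow, Real.sq_sqrt hw0, Real.sq_sqrt hg0]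
      ring
    rw [this, ← Finset.mul_sum]
    exact div_mul_cancel₀ _ hg
  ext i
  by_cases h : (i : ℕ) < n - b
  · simp [wStar, h]
  · simp only [wStar, h, if_false]
    rw [ht]

lemma ae_tail_ne_zero {n b : ℕ} (hb1 : 1 ≤ b) (hbn : b ≤ n) :
    ∀ᵐ g ∂(stdGaussianPi n), tailNormSq b g ≠ 0 := by
  let i0 : Fin n := ⟨n - 1, by omega⟩
  have h1 : ∀ᵐ g ∂(stdGaussianPi n), g i0 ≠ 0 := by
    have hmp := measurePreserving_eval (fun _ : Fin n => gaussianReal 0 1) i0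
    have : NullSingletonClass (gaussianReal 0 1) :=
      nullSingletonClass_gaussianReal (μ := 0) one_ne_zero
    have h2 : ∀ᵐ t ∂(gaussianReal 0 1), t ≠ 0 := by
      simp only [ae_iff, not_not, Set.ofPred_eq_eq_singleton]
      exact measure_singleton 0
    exact hmp.quasiMeasurePreserving.ae h2
  filter_upwards [h1] with g hg h0
  have := (Finset.sum_eq_zero_iff_of_nonneg (fun i _ => sq_nonneg (g i))).1 h0 i0
    (by simp [i0]; omega)
  exact hg (pow_eq_zero_iff (two_ne_zero) |>.1 this)

lemma gauss_resample {ι : Type*} [Fintype ι] [Nonempty ι] (v : NNReal) (hv : v ≠ 0)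
    (Ψ : (ι → ℝ) → ENNReal) (hΨ : Measurable Ψ) :
    ∫⁻ t, ∫⁻ t', Ψ (fun i => Real.sqrt (∑ j, t j ^ 2) * t' i / Real.sqrt (∑ j, t' j ^ 2))
      ∂(Measure.pi fun _ : ι => gaussianReal 0 1) ∂(Measure.pi fun _ : ι => gaussianReal 0 v)
      = ∫⁻ t, Ψ t ∂(Measure.pi fun _ : ι => gaussianReal 0 v) := by
  have hto : Measurable (WithLp.toLp 2 : (ι → ℝ) → EuclideanSpace ℝ ι) := by
    fun_prop
  have hof : Measurable (WithLp.ofLp : EuclideanSpace ℝ ι → (ι → ℝ)) := by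
    fun_prop
  let Φ : EuclideanSpace ℝ ι → ENNReal := fun y => Ψ (WithLp.ofLp y)
  have hΦ : Measurable Φ := hΨ.comp hof
  have hp : IsProbabilityMeasure ((Measure.pi fun _ : ι => gaussianReal 0 1).map
      (WithLp.toLp 2)) := Measure.isProbabilityMeasure_map hto.aemeasurable
  have hrr := radial_resample (volume : Measure (EuclideanSpace ℝ ι))
    (gprof (Fintype.card ι) v) (gprof (Fintype.card ι) 1)
    (measurable_gprof _ _) (measurable_gprof _ _)
    (by rw [← toLp_gaussian_density 1 one_ne_zero]; exact hp) Φ hΦ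
  rw [← toLp_gaussian_density 1 one_ne_zero, ← toLp_gaussian_density v hv,
    lintegral_map hΦ hto, lintegral_map _ hto] at hrr
  · refine Eq.trans ?_ hrr
    refine lintegral_congr fun t => ?_
    rw [lintegral_map (by fun_prop) hto]
    refine lintegral_congr fun t' => ?_
    have : (fun i => Real.sqrt (∑ j, t j ^ 2) * t' i / Real.sqrt (∑ j, t' j ^ 2))
        = WithLp.ofLp ((‖WithLp.toLp 2 t‖ / ‖WithLp.toLp 2 t'‖) • WithLp.toLp 2 t') := by
      ext i
      simp only [EuclideanSpace.norm_eq, Real.norm_eq_abs, sq_abs, WithLp.ofLp_smul, Pi.smul_apply,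
        smul_eq_mul]
      ring
    rw [this]
  · have : Measurable fun q : EuclideanSpace ℝ ι × EuclideanSpace ℝ ι =>
      Φ ((‖q.1‖ / ‖q.2‖) • q.2) := by fun_prop
    exact this.lintegral_prod_right'

/-- Glue a head and a tail. -/
def glue {n : ℕ} (p : Fin n → Prop) [DecidablePred p] :
    ({i // p i} → ℝ) × ({i // ¬ p i} → ℝ) → (Fin n → ℝ) :=
  fun a i => if h : p i then a.1 ⟨i, h⟩ else a.2 ⟨i, h⟩

lemma glue_preserving {n : ℕ} (p : Fin n → Prop) [DecidablePred p] (μ : Fin n → Measure ℝ)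
    [∀ i, IsProbabilityMeasure (μ i)] :
    MeasurePreserving (glue p)
      ((Measure.pi fun i : {i // p i} => μ i).prod (Measure.pi fun i : {i // ¬ p i} => μ i))
      (Measure.pi μ) :=
  (measurePreserving_piEquivPiSubtypeProd μ p).symm
    (MeasurableEquiv.piEquivPiSubtypeProd (fun _ : Fin n => ℝ) p)

lemma glue_inv {n : ℕ} (p : Fin n → Prop) [DecidablePred p] [Nonempty {i // ¬ p i}]
    (m : Fin n → ℝ) (hm : ∀ i, ¬ p i → m i = 0) (v : NNReal) (hv : v ≠ 0)
    (A : (Fin n → ℝ) → (Fin n → ℝ) → (Fin n → ℝ))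
    (hA : Measurable fun q : (Fin n → ℝ) × (Fin n → ℝ) => A q.1 q.2)
    (hst : ∀ (h h' : {i // p i} → ℝ) (t t' : {i // ¬ p i} → ℝ),
      A (glue p (h, t)) (glue p (h', t'))
        = glue p (h, fun i => Real.sqrt (∑ j, t j ^ 2) * t' i / Real.sqrt (∑ j, t' j ^ 2)))
    (F : (Fin n → ℝ) → ENNReal) (hF : Measurable F) :
    ∫⁻ w, ∫⁻ g, F (A w g) ∂(Measure.pi fun _ : Fin n => gaussianReal 0 1)
      ∂(Measure.pi fun i => gaussianReal (m i) v)
      = ∫⁻ w, F w ∂(Measure.pi fun i => gaussianReal (m i) v) := by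
  have hν := glue_preserving p (fun i : Fin n => gaussianReal (m i) v)
  have hγ := glue_preserving p (fun _ : Fin n => gaussianReal 0 1)
  have htail : (Measure.pi fun i : {i // ¬ p i} => gaussianReal (m i) v)
      = Measure.pi fun _ : {i // ¬ p i} => gaussianReal 0 v := by
    congr 1; ext1 i; rw [hm i i.2]
  rw [htail] at hν
  have hmF : Measurable fun q : (Fin n → ℝ) × (Fin n → ℝ) => F (A q.1 q.2) := hF.comp hA
  have hemeas : Measurable (glue p) := hν.measurable
  have hml : Measurable fun w => ∫⁻ g, F (A w g) ∂(Measure.pi fun _ : Fin n => gaussianReal 0 1) :=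
    hmF.lintegral_prod_right'
  have hml2 : Measurable fun a => ∫⁻ g, F (A (glue p a) g)
      ∂(Measure.pi fun _ : Fin n => gaussianReal 0 1) := hml.comp hemeas
  have hF2 : Measurable fun a => F (glue p a) := hF.comp hemeas
  rw [← hν.lintegral_comp hml, ← hν.lintegral_comp hF,
    lintegral_prod _ hml2.aemeasurable, lintegral_prod _ hF2.aemeasurable]
  refine lintegral_congr fun h => ?_
  have hΨ : Measurable fun t => F (glue p (h, t)) := hF2.comp measurable_prodMk_left
  rw [← gauss_resample v hv (fun t => F (glue p (h, t))) hΨ]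
  refine lintegral_congr fun t => ?_
  have hm1 : Measurable fun g => F (A (glue p (h, t)) g) := hmF.comp measurable_prodMk_left
  have hm2 : Measurable fun a => F (A (glue p (h, t)) (glue p a)) := hm1.comp hemeas
  rw [← hγ.lintegral_comp hm1, lintegral_prod _ hm2.aemeasurable]
  simp only [hst]
  rw [lintegral_const, measure_univ, mul_one]

lemma wStar_glue {n b : ℕ} (h h' : {i : Fin n // (i : ℕ) < n - b} → ℝ)
    (t t' : {i : Fin n // ¬ (i : ℕ) < n - b} → ℝ) :
    wStar b (glue (fun i : Fin n => (i : ℕ) < n - b) (h, t)) (glue _ (h', t'))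
      = glue (fun i : Fin n => (i : ℕ) < n - b)
        (h, fun i => Real.sqrt (∑ j, t j ^ 2) * t' i / Real.sqrt (∑ j, t' j ^ 2)) := by
  have hn : ∀ (h : {i : Fin n // (i : ℕ) < n - b} → ℝ) (t : {i : Fin n // ¬ (i : ℕ) < n - b} → ℝ),
      tailNormSq b (glue (fun i : Fin n => (i : ℕ) < n - b) (h, t)) = ∑ j, t j ^ 2 := by
    intro h t
    rw [tailNormSq_eq]
    refine Finset.sum_congr rfl fun i _ => ?_
    rw [glue, dif_neg i.2]
  ext i
  unfold wStar
  rw [hn, hn]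
  by_cases hi : (i : ℕ) < n - b
  · rw [if_pos hi, glue, glue, dif_pos hi, dif_pos hi]
  · rw [if_neg hi, glue, glue, dif_neg hi, dif_neg hi]

lemma wStar_inv {n b : ℕ} (hb1 : 1 ≤ b) (hbn : b ≤ n) (m : Fin n → ℝ)
    (hm : ∀ i : Fin n, n - b ≤ (i : ℕ) → m i = 0) (v : NNReal) (hv : v ≠ 0)
    (F : (Fin n → ℝ) → ENNReal) (hF : Measurable F) :
    ∫⁻ w, ∫⁻ g, F (wStar b w g) ∂(stdGaussianPi n) ∂(Measure.pi fun i => gaussianReal (m i) v)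
      = ∫⁻ w, F w ∂(Measure.pi fun i => gaussianReal (m i) v) := by
  have : Nonempty {i : Fin n // ¬ (i : ℕ) < n - b} := ⟨⟨⟨n - 1, by omega⟩, by simp only; omega⟩⟩
  exact glue_inv (fun i : Fin n => (i : ℕ) < n - b) m (fun i hi => hm i (not_lt.1 hi)) v hv
    (wStar b) (measurable_wStar b) wStar_glue F hF

/-! discrete part -/

instance permMS (n : ℕ) : MeasurableSpace (Equiv.Perm (Fin n)) := ⊤
instance permDMS (n : ℕ) : DiscreteMeasurableSpace (Equiv.Perm (Fin n)) := ⟨fun _ => trivial⟩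

def permLaw (n b : ℕ) : Measure (Equiv.Perm (Fin n)) := uniformOn (permSet n b : Set _)

lemma one_mem_permSet (n b : ℕ) : (1 : Equiv.Perm (Fin n)) ∈ permSet n b := by simp [permSet]

instance (n b : ℕ) : IsProbabilityMeasure (permLaw n b) :=
  isProbabilityMeasure_uniformOn (Finset.finite_toSet _) ⟨1, one_mem_permSet n b⟩

open Classical in
lemma permLaw_apply (n b : ℕ) (U : Equiv.Perm (Fin n) → Prop) :
    permLaw n b {ψ | U ψ} = ((permSet n b).filter U).card / (permSet n b).card := by
  have := uniformOn_apply_finset (s := permSet n b) (t := Finset.univ.filter U)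
  rw [permLaw]
  have h2 : {ψ | U ψ} = ((Finset.univ.filter U : Finset (Equiv.Perm (Fin n))) : Set _) := by
    ext; simp
  rw [h2, this]
  congr 3
  ext; simp

lemma mul_mem_permSet {n b : ℕ} {ψ χ : Equiv.Perm (Fin n)} (hψ : ψ ∈ permSet n b)
    (hχ : χ ∈ permSet n b) : ψ * χ ∈ permSet n b := by
  simp only [permSet, Finset.mem_filter, Finset.mem_univ, true_and] at *
  intro i hi
  rw [Equiv.Perm.mul_apply, hχ i hi, hψ i hi]

lemma inv_mem_permSet {n b : ℕ} {ψ : Equiv.Perm (Fin n)} (hψ : ψ ∈ permSet n b) :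
    ψ⁻¹ ∈ permSet n b := by
  simp only [permSet, Finset.mem_filter, Finset.mem_univ, true_and] at *
  intro i hi
  rw [Equiv.Perm.inv_eq_iff_eq, hψ i hi]

lemma perm_comp {n b : ℕ} {ψ : Equiv.Perm (Fin n)} (hψ : ψ ∈ permSet n b) (w : Fin n → ℝ)
    (B : Set (Fin n → ℝ)) :
    permLaw n b {ψ' | (w ∘ ψ) ∘ ψ' ∈ B} = permLaw n b {ψ' | w ∘ ψ' ∈ B} := by
  classical
  rw [permLaw_apply, permLaw_apply]
  congr 2
  refine Finset.card_bij (fun χ _ => ψ * χ) ?_ ?_ ?_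
  · intro χ hχ
    rw [Finset.mem_filter] at *
    exact ⟨mul_mem_permSet hψ hχ.1, hχ.2⟩
  · intro χ _ χ' _ h
    exact mul_left_cancel h
  · intro χ hχ
    rw [Finset.mem_filter] at hχ
    refine ⟨ψ⁻¹ * χ, ?_, by simp⟩
    rw [Finset.mem_filter]
    refine ⟨mul_mem_permSet (inv_mem_permSet hψ) hχ.1, ?_⟩
    convert hχ.2 using 1
    ext i; simp

lemma perm_preserving {n b : ℕ} {ψ : Equiv.Perm (Fin n)} (hψ : ψ ∈ permSet n b) (m : Fin n → ℝ)
    (hm : ∀ i : Fin n, n - b ≤ (i : ℕ) → m i = 0) (v : NNReal) :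
    MeasurePreserving (fun w : Fin n → ℝ => w ∘ ψ) (Measure.pi fun i => gaussianReal (m i) v)
      (Measure.pi fun i => gaussianReal (m i) v) := by
  have h := measurePreserving_piCongrLeft (fun i => gaussianReal (m i) v) (ψ⁻¹ : Equiv.Perm (Fin n))
  have hψ' := inv_mem_permSet hψ
  simp only [permSet, Finset.mem_filter, Finset.mem_univ, true_and] at hψ'
  have hmm : ∀ i, m (ψ⁻¹ i) = m i := by
    intro i
    by_cases hi : (i : ℕ) < n - b
    · rw [hψ' i hi]
    · rw [hm i (not_lt.1 hi), hm]
      by_contra hc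
      have := ψ⁻¹.injective (hψ' _ (not_le.1 hc))
      rw [this] at hc
      omega
  simp only [hmm] at h
  have heq : (fun w : Fin n → ℝ => w ∘ ψ)
      = ⇑(MeasurableEquiv.piCongrLeft (fun _ : Fin n => ℝ) ψ⁻¹) := by
    funext w i
    have := Equiv.piCongrLeft_apply_apply (fun _ : Fin n => ℝ) ψ⁻¹ w (ψ i)
    have h2 := congrArg (fun j : Fin n => (Equiv.piCongrLeft (fun _ : Fin n => ℝ) ψ⁻¹ w : Fin n → ℝ) j)
      (show ψ⁻¹ (ψ i) = i from ψ.symm_apply_apply i)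
    exact this.symm.trans h2
  rw [heq]
  exact h

lemma perm_inv {n b : ℕ} (m : Fin n → ℝ)
    (hm : ∀ i : Fin n, n - b ≤ (i : ℕ) → m i = 0) (v : NNReal)
    (hA : Measurable fun p : (Fin n → ℝ) × Equiv.Perm (Fin n) => p.1 ∘ p.2)
    (F : (Fin n → ℝ) → ENNReal) (hF : Measurable F) :
    ∫⁻ w, ∫⁻ ψ, F (w ∘ ψ) ∂(permLaw n b) ∂(Measure.pi fun i => gaussianReal (m i) v)
      = ∫⁻ w, F w ∂(Measure.pi fun i => gaussianReal (m i) v) := by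
  have hmem : ∀ᵐ ψ ∂(permLaw n b), ψ ∈ permSet n b := by
    unfold permLaw uniformOn
    exact ae_cond_mem (by measurability)
  rw [lintegral_lintegral_swap (f := fun w (ψ : Equiv.Perm (Fin n)) => F (w ∘ ψ))
    (hF.comp hA).aemeasurable]
  rw [lintegral_congr_ae (g := fun _ => ∫⁻ w, F w ∂(Measure.pi fun i => gaussianReal (m i) v))]
  · simp
  · filter_upwards [hmem] with ψ hψ
    exact (perm_preserving hψ m hm v).lintegral_comp hF

lemma pDisc_eq {n d H : ℕ} (X : Fin n → Fin d → ℝ) (Z : Fin n → Fin H)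
    (T : (Fin n → Fin d → ℝ) → (Fin n → ℝ) → (Fin n → Fin H) → ℝ)
    (Γ : Fin n → Fin n → ℝ) (b : ℕ) (Y : Fin n → ℝ) :
    pDisc X Z T Γ b Y = (permLaw n b
      {ψ | T X Y Z ≤ T X (mulVecF Γ ((tmulVecF Γ Y) ∘ ψ)) Z}).toReal := by
  classical
  rw [permLaw_apply, pDisc, ENNReal.toReal_div, Finset.sum_boole]
  simp only [ENNReal.toReal_natCast]
  rw [div_eq_inv_mul]

/-! linear algebra -/

lemma mulVecF_tmulVecF {n : ℕ} {Γ : Fin n → Fin n → ℝ} (h : IsOrthogonalF Γ) (y : Fin n → ℝ) :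
    mulVecF Γ (tmulVecF Γ y) = y := by
  ext i
  simp only [mulVecF, tmulVecF, Finset.mul_sum]
  rw [Finset.sum_comm]
  have : ∀ j, ∑ k, Γ i k * (Γ j k * y j) = (if i = j then (1 : ℝ) else 0) * y j := by
    intro j
    rw [← h i j, Finset.sum_mul]
    exact Finset.sum_congr rfl fun k _ => by ring
  simp [this]

lemma tail_mean_zero {n d q : ℕ} (X : Fin n → Fin d → ℝ)
    (φ : (Fin d → ℝ) → Fin q → ℝ) (f0 : (Fin d → ℝ) → ℝ) (β : Fin q → ℝ)
    (hf0 : ∀ x, f0 x = ∑ l, β l * φ x l) (Kn : Fin n → Fin n → ℝ)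
    (hKn : ∀ i j, Kn i j = ∑ l, φ (X i) l * φ (X j) l)
    (Γ : Fin n → Fin n → ℝ) (c : Fin n → ℝ) (hEig : IsEigenDecomp Kn Γ c)
    (k : Fin n) (hk : q ≤ (k : ℕ)) : tmulVecF Γ (fun i => f0 (X i)) k = 0 := by
  obtain ⟨hO, hK, hdec, hnn⟩ := hEig
  let G : Matrix (Fin n) (Fin n) ℝ := Matrix.of Γ
  let P : Matrix (Fin n) (Fin q) ℝ := Matrix.of fun i l => φ (X i) l
  have hGG : G * G.transpose = 1 := by
    ext i j
    simp [Matrix.mul_apply, G, Matrix.one_apply, hO i j]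
  have hGG' : G.transpose * G = 1 := mul_eq_one_comm.1 hGG
  have hKK : G * Matrix.diagonal c * G.transpose = P * P.transpose := by
    ext i j
    rw [Matrix.mul_apply, Matrix.mul_apply]
    simp only [Matrix.mul_diagonal, Matrix.transpose_apply, G, P, Matrix.of_apply]
    rw [← hK i j, hKn i j]
  have hD : Matrix.diagonal c = (G.transpose * P) * (G.transpose * P).transpose := by
    calc Matrix.diagonal c = (G.transpose * G) * Matrix.diagonal c * (G.transpose * G) := by
          rw [hGG']; simp
      _ = G.transpose * (G * Matrix.diagonal c * G.transpose) * G := by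
          simp only [Matrix.mul_assoc]
      _ = _ := by
          rw [hKK, Matrix.transpose_mul, Matrix.transpose_transpose]; simp only [Matrix.mul_assoc]
  have hck : c k = 0 := by
    by_contra hne
    have hpos : 0 < c k := lt_of_le_of_ne (hnn k) (Ne.symm hne)
    have hr : (Matrix.diagonal c).rank ≤ q := by
      rw [hD]
      refine (Matrix.rank_mul_le_left _ _).trans ?_
      exact (Matrix.rank_le_card_width _).trans (by simp)
    rw [Matrix.rank_diagonal] at hr
    have hinj : Function.Injective (fun j : Fin (k + 1) =>
        (⟨⟨j, by omega⟩, (lt_of_lt_of_le hpos (hdec ⟨j, by omega⟩ k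
          (by rw [Fin.le_def]; simp; omega))).ne'⟩ : {i // c i ≠ 0})) := by
      intro j j' h
      simp only [Subtype.mk.injEq, Fin.mk.injEq] at h
      exact Fin.ext h
    have := Fintype.card_le_of_injective _ hinj
    simp only [Fintype.card_fin] at this
    omega
  have hsum : ∑ l, (G.transpose * P) k l ^ 2 = 0 := by
    have := congrFun (congrFun hD k) k
    rw [Matrix.diagonal_apply_eq, hck, Matrix.mul_apply] at this
    rw [this]
    exact Finset.sum_congr rfl fun l _ => by rw [Matrix.transpose_apply, sq]
  have hz : ∀ l, ∑ j, Γ j k * φ (X j) l = 0 := by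
    intro l
    have := (Finset.sum_eq_zero_iff_of_nonneg (fun l _ => sq_nonneg _)).1 hsum l (Finset.mem_univ _)
    have := pow_eq_zero_iff (two_ne_zero) |>.1 this
    simpa [Matrix.mul_apply, G, P] using this
  simp only [tmulVecF, hf0, Finset.mul_sum]
  rw [Finset.sum_comm]
  refine Finset.sum_eq_zero fun l _ => ?_
  calc ∑ j, Γ j k * (β l * φ (X j) l) = β l * ∑ j, Γ j k * φ (X j) l := by
        rw [Finset.mul_sum]; exact Finset.sum_congr rfl fun j _ => by ring
    _ = 0 := by rw [hz, mul_zero]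

lemma tmulVecF_sq {n : ℕ} {Γ : Fin n → Fin n → ℝ} (h : IsOrthogonalF Γ) (y : Fin n → ℝ) :
    ∑ i, tmulVecF Γ y i ^ 2 = ∑ i, y i ^ 2 := by
  calc ∑ i, tmulVecF Γ y i ^ 2 = ∑ i, ∑ j, Γ j i * y j * tmulVecF Γ y i := by
        refine Finset.sum_congr rfl fun i _ => ?_
        rw [← Finset.sum_mul, sq]; rfl
    _ = ∑ j, y j * mulVecF Γ (tmulVecF Γ y) j := by
        rw [Finset.sum_comm]
        refine Finset.sum_congr rfl fun j _ => ?_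
        simp only [mulVecF]
        rw [Finset.mul_sum]
        exact Finset.sum_congr rfl fun i _ => by ring
    _ = _ := by
        rw [mulVecF_tmulVecF h]
        exact Finset.sum_congr rfl fun i _ => by ring

lemma measurable_tmulVecF {n : ℕ} (Γ : Fin n → Fin n → ℝ) : Measurable (tmulVecF Γ) := by
  unfold tmulVecF; fun_prop

lemma measurable_mulVecF {n : ℕ} (Γ : Fin n → Fin n → ℝ) : Measurable (mulVecF Γ) := by
  unfold mulVecF; fun_prop

lemma noise_rot_s2 {n : ℕ} {Γ : Fin n → Fin n → ℝ} (h : IsOrthogonalF Γ) (v : NNReal) (hv : v ≠ 0) :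
    (Measure.pi fun _ : Fin n => gaussianReal 0 v).map (tmulVecF Γ)
      = Measure.pi fun _ : Fin n => gaussianReal 0 v := by
  let L0 : EuclideanSpace ℝ (Fin n) →ₗ[ℝ] EuclideanSpace ℝ (Fin n) :=
    { toFun := fun x => WithLp.toLp 2 (tmulVecF Γ x)
      map_add' := by
        intro x y; ext i; simp [tmulVecF, mul_add, Finset.sum_add_distrib]
      map_smul' := by
        intro r x; ext i
        simp only [tmulVecF, PiLp.smul_apply, smul_eq_mul, RingHom.id_apply, Finset.mul_sum]
        exact Finset.sum_congr rfl fun j _ => by ring }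
  let L1 : EuclideanSpace ℝ (Fin n) →ₗᵢ[ℝ] EuclideanSpace ℝ (Fin n) :=
    { L0 with
      norm_map' := by
        intro x
        simp only [L0, LinearMap.coe_mk, AddHom.coe_mk, EuclideanSpace.norm_eq, Real.norm_eq_abs,
          sq_abs]
        rw [tmulVecF_sq h] }
  have hL := gaussian_isometry v hv (L1.toLinearIsometryEquiv rfl)
  have hto : Measurable (WithLp.toLp 2 : (Fin n → ℝ) → EuclideanSpace ℝ (Fin n)) := by
    fun_prop
  have hof : Measurable (WithLp.ofLp : EuclideanSpace ℝ (Fin n) → (Fin n → ℝ)) := by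
    fun_prop
  have h2 := congrArg (fun μ => Measure.map (WithLp.ofLp) μ) hL
  simp only at h2
  rw [Measure.map_map (by fun_prop) hto, Measure.map_map hof (by fun_prop),
    Measure.map_map hof hto] at h2
  have h3 : (WithLp.ofLp ∘ WithLp.toLp 2 : (Fin n → ℝ) → (Fin n → ℝ)) = id := rfl
  rw [h3, Measure.map_id] at h2
  exact h2

lemma law_W {n : ℕ} {Γ : Fin n → Fin n → ℝ} (h : IsOrthogonalF Γ) (f : Fin n → ℝ) (σ : ℝ)
    (hσ : 0 < σ) :
    (Measure.map (fun ε : Fin n → ℝ => fun i => f i + ε i) (noiseLaw n σ)).map (tmulVecF Γ)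
      = Measure.pi fun i => gaussianReal (tmulVecF Γ f i) ((σ ^ 2).toNNReal) := by
  have hv : (σ ^ 2).toNNReal ≠ 0 := by
    rw [ne_eq, Real.toNNReal_eq_zero, not_le]; positivity
  rw [Measure.map_map (measurable_tmulVecF Γ) (by fun_prop)]
  have : (tmulVecF Γ ∘ fun ε : Fin n → ℝ => fun i => f i + ε i)
      = (fun x : Fin n → ℝ => fun i => tmulVecF Γ f i + x i) ∘ tmulVecF Γ := by
    ext ε i
    simp [tmulVecF, mul_add, Finset.sum_add_distrib]
  rw [this, ← Measure.map_map (by fun_prop) (measurable_tmulVecF Γ), noiseLaw, noise_rot_s2 h _ hv]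
  have h2 := Measure.pi_map_pi (μ := fun _ : Fin n => gaussianReal 0 ((σ ^ 2).toNNReal))
    (f := fun i (t : ℝ) => tmulVecF Γ f i + t) (fun i => by fun_prop)
  rw [h2]
  congr 1
  ext1 i
  rw [gaussianReal_map_const_add, zero_add]

end PPT

open PPT in
/-- Corollary 1: validity of the discrete and continuous partial permutation
tests for a kernel with a finite-dimensional feature space `K(x,x') = φ(x)ᵀφ(x')`, when the true
regression function is linear in the features and the noises are i.i.d. centered Gaussian. -/
theorem partial_permutation_valid_finite_feature
    {n d H q : ℕ} (hn : 1 ≤ n) (hd : 1 ≤ d)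
    (X : Fin n → Fin d → ℝ) (Z : Fin n → Fin H)
    -- the feature map defining the kernel K(x,x') = φ(x)ᵀφ(x')
    (φ : (Fin d → ℝ) → Fin q → ℝ)
    -- the true functional relationship is linear in the features
    (f0 : (Fin d → ℝ) → ℝ) (β : Fin q → ℝ)
    (hf0 : ∀ x, f0 x = ∑ l, β l * φ x l)
    -- noise level
    (σ0 : ℝ) (hσ0 : 0 < σ0)
    -- the law of Y = f0(X) + ε with ε ~ N(0, σ0² Iₙ)
    (μY : Measure (Fin n → ℝ))
    (hμY : μY = Measure.map (fun ε : Fin n → ℝ => fun i => f0 (X i) + ε i) (noiseLaw n σ0))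
    -- sample kernel matrix
    (Kn : Fin n → Fin n → ℝ)
    (hKn : ∀ i j, Kn i j = ∑ l, φ (X i) l * φ (X j) l)
    -- a fixed eigendecomposition Kn = Γ diag(c) Γᵀ
    (Γ : Fin n → Fin n → ℝ) (c : Fin n → ℝ) (hEig : IsEigenDecomp Kn Γ c)
    -- permutation size
    (b : ℕ) (hb1 : 1 ≤ b) (hb2 : b ≤ n - q)
    -- arbitrary (measurable) test statistic
    (T : (Fin n → Fin d → ℝ) → (Fin n → ℝ) → (Fin n → Fin H) → ℝ)
    (hT : Measurable fun y => T X y Z) :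
    ∀ α ∈ Set.Ioo (0 : ℝ) 1,
      μY {y | pDisc X Z T Γ b y ≤ α} ≤ ENNReal.ofReal α ∧
      μY {y | pCont X Z T Γ b y ≤ α} ≤ ENNReal.ofReal α := by
  intro α hα
  have hO := hEig.1
  have hm : ∀ i : Fin n, n - b ≤ (i : ℕ) → tmulVecF Γ (fun i => f0 (X i)) i = 0 := fun i hi =>
    tail_mean_zero X φ f0 β hf0 Kn hKn Γ c hEig i (by omega)
  have hv : (σ0 ^ 2).toNNReal ≠ 0 := by
    rw [ne_eq, Real.toNNReal_eq_zero, not_le]; positivity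
  have hlaw := law_W hO (fun i => f0 (X i)) σ0 hσ0
  rw [← hμY] at hlaw
  have hS : Measurable fun w => T X (mulVecF Γ w) Z := hT.comp (measurable_mulVecF Γ)
  have hpi : IsProbabilityMeasure (stdGaussianPi n) := by unfold stdGaussianPi; infer_instance
  have hAd : Measurable fun p : (Fin n → ℝ) × Equiv.Perm (Fin n) => p.1 ∘ p.2 :=
    measurable_from_prod_countable_left fun ψ => by
      refine measurable_pi_lambda _ fun i => ?_
      exact measurable_pi_apply (ψ i)
  constructor
  · have hmem : ∀ᵐ ψ ∂(permLaw n b), ψ ∈ permSet n b := by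
      unfold permLaw uniformOn
      exact ae_cond_mem (by measurability)
    obtain ⟨hD, hle⟩ := valid_general
      (Measure.pi fun i => gaussianReal (tmulVecF Γ (fun i => f0 (X i)) i) ((σ0 ^ 2).toNNReal))
      (permLaw n b) (fun ψ w => w ∘ ψ) hAd (fun F hF => perm_inv _ hm _ hAd F hF)
      (by filter_upwards [hmem] with ψ hψ w B _ using perm_comp hψ w B)
      _ hS α hα.1.le
    rw [← hlaw, Measure.map_apply (measurable_tmulVecF Γ) hD] at hle
    convert hle using 2
    ext y
    simp only [Set.mem_ofPred_eq, Set.mem_preimage, pDisc_eq, mulVecF_tmulVecF hO]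
  · obtain ⟨hD, hle⟩ := valid_general
      (Measure.pi fun i => gaussianReal (tmulVecF Γ (fun i => f0 (X i)) i) ((σ0 ^ 2).toNNReal))
      (stdGaussianPi n) (fun g w => wStar b w g) (measurable_wStar b)
      (fun F hF => wStar_inv hb1 (by omega) _ hm _ hv F hF)
      (by
        filter_upwards [ae_tail_ne_zero (n := n) hb1 (by omega)] with g hg w B _
        simp only [wStar_wStar b w g _ hg])
      _ hS α hα.1.le
    rw [← hlaw, Measure.map_apply (measurable_tmulVecF Γ) hD] at hle
    convert hle using 2
    ext y
    simp only [Set.mem_ofPred_eq, Set.mem_preimage, pCont, mulVecF_tmulVecF hO]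
end
end
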